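/- arXiv:1208.5540 — 9 statements merged into one kernel-verified Lean document; each statement's English description precedes it below -/
import Mathlib

section
/- Let $m,n\ge 1$ be integers, $p>1$, $R>0$, $c>0$, and let $\kappa_1^+,\dots,\kappa_m^+>0$, $\kappa_1^-,\dots,\kappa_n^->0$ and arbitrary real constants $q_i^+,q_j^-,g_i^+,g_j^-$ ($1\le i\le m$, $1\le j\le n$), $A_{ik}$ ($i\ne k$), $B_{jl}$ ($j\ne l$), $C_{il}$, $D_{jk}$ be given. Then there exists $\varepsilon_0\in(0,1)$ such that for every $\varepsilon\in(0,\varepsilon_0)$, setting $\delta=\varepsilon\,(2\pi/\ln(1/\varepsilon))^{(p-1)/2}$, there exist $s_1^+,\dots,s_m^+,s_1^-,\dots,s_n^-\in(0,R)$ and $a_1^+,\dots,a_m^+,a_1^-,\dots,a_n^->0$ solving the system (S). -/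
open Real Set Finset

open Filter Topology

/-- For parameters `(t, u, v)` near `0`, the perturbation
`y (1 + u log y / α - v) = κ + t β + u M y` of `y = κ` has a solution with all factors positive. -/
theorem eventually_exists_log_perturbation {ι : Type*} [Fintype ι] (α : ℝ) (κ β : ι → ℝ)
    (hκ : ∀ i, 0 < κ i) (M : ι → ι → ℝ) :
    ∀ᶠ w : ℝ × ℝ × ℝ in 𝓝 0, ∃ y : ι → ℝ, ∀ i, 0 < y i ∧
      0 < 1 + w.2.1 * Real.log (y i) / α - w.2.2 ∧
      y i * (1 + w.2.1 * Real.log (y i) / α - w.2.2) =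
        κ i + w.1 * β i + w.2.1 * ∑ j, M i j * y j := by
  let g : (ι → ℝ) → ι → ℝ := fun y i => y i * Real.log (y i) / α - ∑ j, M i j * y j
  have hg : HasStrictFDerivAt g (fderiv ℝ g κ) κ := by
    refine ContDiffAt.hasStrictFDerivAt (n := 1) (contDiffAt_pi.2 fun i => ?_) one_ne_zero
    have hi : ContDiffAt ℝ 1 (fun y : ι → ℝ => y i) κ := by fun_prop
    exact ((hi.mul (hi.log (hκ i).ne')).div_const α).sub (by fun_prop)
  let x₀ : (ι → ℝ) × ℝ × ℝ × ℝ := (κ, 0)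
  let Φ : (ι → ℝ) × ℝ × ℝ × ℝ → (ι → ℝ) × ℝ × ℝ × ℝ := fun x =>
    (x.1 - κ - x.2.1 • β + x.2.2.1 • g x.1 - x.2.2.2 • x.1, x.2)
  have hy : HasStrictFDerivAt (fun x : (ι → ℝ) × ℝ × ℝ × ℝ => x.1)
      (ContinuousLinearMap.fst ℝ _ _) x₀ :=
    hasStrictFDerivAt_fst
  have hw : HasStrictFDerivAt (fun x : (ι → ℝ) × ℝ × ℝ × ℝ => x.2)
      (ContinuousLinearMap.snd ℝ _ _) x₀ :=
    hasStrictFDerivAt_snd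
  have hgy : HasStrictFDerivAt (fun x : (ι → ℝ) × ℝ × ℝ × ℝ => g x.1) _ x₀ := hg.comp x₀ hy
  have hΦ := ((((hy.sub_const κ).sub (hw.fst.smul_const β)).add
    (hw.snd.fst.smul hgy)).sub (hw.snd.snd.smul hy)).prodMk hw
  have hmap := hΦ.map_nhds_eq_of_surj (LinearMap.range_eq_top.2 (by
    rintro ⟨e, t, u, v⟩
    refine ⟨(e + t • β - u • g κ + v • κ, t, u, v), ?_⟩
    refine Prod.ext ?_ rfl
    simp [x₀]
    abel))
  have hΦ₀ : Φ x₀ = 0 := by simp [Φ, x₀, Prod.ext_iff]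
  have hpos : ∀ᶠ x : (ι → ℝ) × ℝ × ℝ × ℝ in 𝓝 x₀, ∀ i, 0 < x.1 i ∧
      0 < 1 + x.2.2.1 * Real.log (x.1 i) / α - x.2.2.2 := by
    refine eventually_all.2 fun i => ?_
    have h1 : ContinuousAt (fun x : (ι → ℝ) × ℝ × ℝ × ℝ => x.1 i) x₀ := by fun_prop
    have h2 : ContinuousAt
        (fun x : (ι → ℝ) × ℝ × ℝ × ℝ => 1 + x.2.2.1 * Real.log (x.1 i) / α - x.2.2.2) x₀ := by
      have := h1.log (hκ i).ne'
      fun_prop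
    exact (h1.eventually (lt_mem_nhds (hκ i))).and
      (h2.eventually (lt_mem_nhds (by simp [x₀])))
  have himage : Φ '' {x : (ι → ℝ) × ℝ × ℝ × ℝ | ∀ i, 0 < x.1 i ∧
      0 < 1 + x.2.2.1 * Real.log (x.1 i) / α - x.2.2.2} ∈ 𝓝 (0 : (ι → ℝ) × ℝ × ℝ × ℝ) := by
    rw [← hΦ₀]
    exact hmap ▸ image_mem_map hpos
  have hcont : Tendsto (fun w : ℝ × ℝ × ℝ => ((0, w) : (ι → ℝ) × ℝ × ℝ × ℝ)) (𝓝 0) (𝓝 0) :=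
    Continuous.tendsto' (by fun_prop) _ _ rfl
  filter_upwards [hcont himage] with w hw'
  obtain ⟨⟨y, w'⟩, hyw, heq⟩ := hw'
  obtain rfl : w' = w := congrArg Prod.snd heq
  refine ⟨y, fun i => ⟨(hyw i).1, (hyw i).2, ?_⟩⟩
  have := congrFun (congrArg Prod.fst heq) i
  simp only [Φ, g, Pi.add_apply, Pi.sub_apply, Pi.smul_apply, Pi.zero_apply, smul_eq_mul] at this
  linear_combination this

/-- As `t → 0` and `b → 0⁺`, the coupled equations
`b exp (α L) = a / L`, `a = κ + t β + M (a / L)` eventually have a positive solution. -/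
theorem eventually_exists_exp_system {ι X : Type*} [Fintype ι] {l : Filter X} {α : ℝ}
    (hα : 0 < α) (κ β : ι → ℝ) (hκ : ∀ i, 0 < κ i) (M : ι → ι → ℝ) {t b : X → ℝ}
    (ht : Tendsto t l (𝓝 0)) (hb : Tendsto b l (𝓝[>] 0)) :
    ∀ᶠ ε in l, ∃ L a : ι → ℝ, ∀ i, 0 < L i ∧ 0 < a i ∧
      b ε * Real.exp (α * L i) = a i / L i ∧
      a i = κ i + t ε * β i + ∑ j, M i j * (a j / L j) := by
  let Λ : X → ℝ := fun ε => -Real.log (b ε) / α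
  have hΛ : Tendsto Λ l atTop :=
    (tendsto_neg_atBot_atTop.comp (Real.tendsto_log_nhdsGT_zero.comp hb)).atTop_div_const hα
  have hu : Tendsto (fun ε => (Λ ε)⁻¹) l (𝓝 0) := tendsto_inv_atTop_zero.comp hΛ
  have hv : Tendsto (fun ε => Real.log (Λ ε) / Λ ε / α) l (𝓝 0) := by
    simpa using
      ((Real.isLittleO_log_id_atTop.tendsto_div_nhds_zero).comp hΛ).div_const α
  have hw : Tendsto (fun ε => (t ε, (Λ ε)⁻¹, Real.log (Λ ε) / Λ ε / α)) l (𝓝 0) :=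
    ht.prodMk_nhds (hu.prodMk_nhds hv)
  filter_upwards [hw.eventually (eventually_exists_log_perturbation α κ β hκ M),
    hΛ.eventually_gt_atTop 0, hb self_mem_nhdsWithin] with ε ⟨y, hy⟩ hΛ0 hb0
  have hb0 : 0 < b ε := hb0
  set r : ι → ℝ := fun i => 1 + (Λ ε)⁻¹ * Real.log (y i) / α - Real.log (Λ ε) / Λ ε / α
  have hr : ∀ i, 0 < r i := fun i => (hy i).2.1
  have hdiv : ∀ i, y i * r i / (Λ ε * r i) = y i / Λ ε := fun i =>
    mul_div_mul_right _ _ (hr i).ne'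
  refine ⟨fun i => Λ ε * r i, fun i => y i * r i, fun i =>
    ⟨mul_pos hΛ0 (hr i), mul_pos (hy i).1 (hr i), ?_, ?_⟩⟩
  · have hL : α * (Λ ε * r i) = -Real.log (b ε) + Real.log (y i) - Real.log (Λ ε) := by
      have : α * Λ ε = -Real.log (b ε) := mul_div_cancel₀ _ hα.ne'
      rw [← this]
      simp only [r]
      field_simp
    simp only [hdiv, hL]
    rw [Real.exp_sub, Real.exp_add, Real.exp_neg, Real.exp_log hb0, Real.exp_log (hy i).1,
      Real.exp_log hΛ0]
    field_simp
  · simp only [hdiv]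
    rw [(hy i).2.2, Finset.mul_sum]
    congr 1
    exact Finset.sum_congr rfl fun j _ => by ring

/-- Lemma 2.1 of the paper at a fixed configuration.
For all the given data there is `ε₀ ∈ (0,1)` such that for every `ε ∈ (0,ε₀)`,
with `δ = ε (2π/log(1/ε))^{(p-1)/2}`, the system (S) admits a solution
`s_i^± ∈ (0,R)`, `a_i^± > 0`. -/
theorem exists_solution_system_S (m n : ℕ) (hm : 1 ≤ m) (hn : 1 ≤ n)
    (p R c : ℝ) (hp : 1 < p) (hR : 0 < R) (hc : 0 < c)
    (κp : Fin m → ℝ) (κm : Fin n → ℝ)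
    (hκp : ∀ i, 0 < κp i) (hκm : ∀ j, 0 < κm j)
    (qp gp : Fin m → ℝ) (qm gm : Fin n → ℝ)
    (A : Fin m → Fin m → ℝ) (B : Fin n → Fin n → ℝ)
    (C : Fin m → Fin n → ℝ) (D : Fin n → Fin m → ℝ) :
    ∃ ε₀ ∈ Ioo (0 : ℝ) 1, ∀ ε ∈ Ioo (0 : ℝ) ε₀,
      ∃ (sp : Fin m → ℝ) (sm : Fin n → ℝ) (ap : Fin m → ℝ) (am : Fin n → ℝ),
        (∀ i, sp i ∈ Ioo (0 : ℝ) R) ∧ (∀ j, sm j ∈ Ioo (0 : ℝ) R) ∧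
        (∀ i, 0 < ap i) ∧ (∀ j, 0 < am j) ∧
        (∀ i, (ε * (2 * π / Real.log (1 / ε)) ^ ((p - 1) / 2)) ^ (2 / (p - 1)) *
            (sp i) ^ (-(2 / (p - 1))) * c = ap i / Real.log (R / sp i)) ∧
        (∀ j, (ε * (2 * π / Real.log (1 / ε)) ^ ((p - 1) / 2)) ^ (2 / (p - 1)) *
            (sm j) ^ (-(2 / (p - 1))) * c = am j / Real.log (R / sm j)) ∧
        (∀ i, ap i = κp i + 2 * π * qp i / Real.log (1 / ε)
            + gp i * ap i / Real.log (R / sp i)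
            - ∑ k ∈ Finset.univ.erase i, A i k * ap k / Real.log (R / sp k)
            + ∑ l, C i l * am l / Real.log (R / sm l)) ∧
        (∀ j, am j = κm j - 2 * π * qm j / Real.log (1 / ε)
            + gm j * am j / Real.log (R / sm j)
            - ∑ l ∈ Finset.univ.erase j, B j l * am l / Real.log (R / sm l)
            + ∑ k, D j k * ap k / Real.log (R / sp k)) := by
  have hp1 : 0 < p - 1 := sub_pos.2 hp
  have hα : 0 < 2 / (p - 1) := by positivity
  set α := 2 / (p - 1) with hαdef
  have hlog : Tendsto (fun ε : ℝ => Real.log (1 / ε)) (𝓝[>] 0) atTop := by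
    simpa [Function.comp_def] using Real.tendsto_log_nhdsGT_zero
  have ht : Tendsto (fun ε : ℝ => (Real.log (1 / ε))⁻¹) (𝓝[>] 0) (𝓝 0) :=
    tendsto_inv_atTop_zero.comp hlog
  have hb : Tendsto (fun ε : ℝ => (ε * (2 * π / Real.log (1 / ε)) ^ ((p - 1) / 2)) ^ α *
      (R ^ (-α) * c)) (𝓝[>] 0) (𝓝[>] 0) := by
    refine tendsto_nhdsWithin_iff.2 ⟨?_, ?_⟩
    · have h1 : Tendsto (fun ε : ℝ => 2 * π / Real.log (1 / ε)) (𝓝[>] 0) (𝓝 0) :=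
        tendsto_const_nhds.div_atTop hlog
      have h2 := h1.rpow_const (p := (p - 1) / 2) (Or.inr (by positivity))
      have hε : Tendsto (fun ε : ℝ => ε) (𝓝[>] 0) (𝓝 0) := nhdsWithin_le_nhds
      simpa [Real.zero_rpow hα.ne'] using
        ((hε.mul h2).rpow_const (p := α) (Or.inr hα.le)).mul_const (R ^ (-α) * c)
    · filter_upwards [hlog.eventually_gt_atTop 0, self_mem_nhdsWithin] with ε h1 h2
      have h2 : 0 < ε := h2
      exact Set.mem_Ioi.2 (by positivity)
  let M : Fin m ⊕ Fin n → Fin m ⊕ Fin n → ℝ :=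
    Sum.elim (fun i => Sum.elim (fun k => if k = i then gp i else -A i k) (C i))
      (fun j => Sum.elim (D j) (fun l => if l = j then gm j else -B j l))
  have hev := eventually_exists_exp_system hα (Sum.elim κp κm)
    (Sum.elim (fun i => 2 * π * qp i) (fun j => -(2 * π * qm j)))
    (Sum.rec hκp hκm) M ht hb
  obtain ⟨ε₁, hε₁, hsub⟩ := mem_nhdsGT_iff_exists_Ioo_subset.1 hev
  have hε₁ : 0 < ε₁ := hε₁
  refine ⟨min ε₁ (1 / 2), ⟨by positivity, (min_le_right _ _).trans_lt (by norm_num)⟩,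
    fun ε hε => ?_⟩
  obtain ⟨L, a, h⟩ := hsub ⟨hε.1, hε.2.trans_le (min_le_left _ _)⟩
  have hs : ∀ x, R * Real.exp (-L x) ∈ Ioo 0 R := fun x =>
    ⟨by positivity, mul_lt_of_lt_one_right hR (Real.exp_lt_one_iff.2 (neg_neg_of_pos (h x).1))⟩
  have hlogs : ∀ x, Real.log (R / (R * Real.exp (-L x))) = L x := fun x => by
    rw [div_mul_cancel_left₀ hR.ne', ← Real.exp_neg, neg_neg, Real.log_exp]
  have hpow : ∀ x, (R * Real.exp (-L x)) ^ (-α) = R ^ (-α) * Real.exp (α * L x) := fun x => by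
    rw [Real.mul_rpow hR.le (Real.exp_pos _).le, ← Real.exp_mul]
    ring_nf
  have hcore : ∀ x, (ε * (2 * π / Real.log (1 / ε)) ^ ((p - 1) / 2)) ^ α *
      (R * Real.exp (-L x)) ^ (-α) * c = a x / Real.log (R / (R * Real.exp (-L x))) := fun x => by
    rw [hlogs, ← (h x).2.2.1, hpow]
    ring
  have hsum : ∀ {k : ℕ} (i : Fin k) (γ : ℝ) (N y z : Fin k → ℝ),
      ∑ x, (if x = i then γ else -N x) * (y x / z x) =
        γ * y i / z i - ∑ x ∈ Finset.univ.erase i, N x * y x / z x := by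
    intro k i γ N y z
    rw [← Finset.add_sum_erase _ _ (Finset.mem_univ i), if_pos rfl, sub_eq_add_neg,
      ← Finset.sum_neg_distrib, mul_div_assoc]
    congr 1
    refine Finset.sum_congr rfl fun x hx => ?_
    rw [if_neg (Finset.ne_of_mem_erase hx)]
    ring
  refine ⟨fun i => R * Real.exp (-L (.inl i)), fun j => R * Real.exp (-L (.inr j)),
    fun i => a (.inl i), fun j => a (.inr j), fun i => hs _, fun j => hs _,
    fun i => (h _).2.1, fun j => (h _).2.1, fun i => hcore _, fun j => hcore _,
    fun i => ?_, fun j => ?_⟩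
  · have := (h (.inl i)).2.2.2
    simp only [M, Fintype.sum_sum_type, Sum.elim_inl, Sum.elim_inr] at this
    rw [hsum i (gp i) (A i) (fun k => a (.inl k)) (fun k => L (.inl k))] at this
    simp only [hlogs]
    simp only [← mul_div_assoc] at this
    linear_combination this
  · have := (h (.inr j)).2.2.2
    simp only [M, Fintype.sum_sum_type, Sum.elim_inl, Sum.elim_inr] at this
    rw [hsum j (gm j) (B j) (fun k => a (.inr k)) (fun k => L (.inr k))] at this
    simp only [hlogs]
    simp only [← mul_div_assoc] at this
    linear_combination this
end

section
/- Let $m,n\ge 1$ be integers, $p>1$, $R>0$, $c>0$, and let $\kappa_1^+,\dots,\kappa_m^+>0$, $\kappa_1^-,\dots,\kappa_n^->0$ and arbitrary real constants $q_i^+,q_j^-,g_i^+,g_j^-$ ($1\le i\le m$, $1\le j\le n$), $A_{ik}$ ($i\ne k$), $B_{jl}$ ($j\ne l$), $C_{il}$, $D_{jk}$ be given. Then there exist $\varepsilon_0\in(0,1/e)$ and $C>0$ such that for every $\varepsilon\in(0,\varepsilon_0)$, setting $\delta=\varepsilon\,(2\pi/\ln(1/\varepsilon))^{(p-1)/2}$,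 the system (S) admits a solution $s_i^\pm\in(0,R)$, $a_i^\pm>0$ which in addition satisfies, for all indices, $\Bigl|\dfrac{1}{\ln(R/s_i^\pm)}-\dfrac{1}{\ln(R/\varepsilon)}\Bigr|\le C\,\dfrac{\ln\ln(1/\varepsilon)}{(\ln(1/\varepsilon))^2}$ and $|a_i^\pm-\kappa_i^\pm|\le \dfrac{C}{\ln(1/\varepsilon)}$; consequently these solutions satisfy $\dfrac{a_i^\pm\,\ln(1/\varepsilon)}{\ln(R/s_i^\pm)}\to\kappa_i^\pm$ as $\varepsilon\to 0^+$. -/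
open Real Set Finset Filter

theorem eventually_exists_eq_add_smul_of_contDiffAt {E : Type*} [NormedAddCommGroup E]
    [NormedSpace ℝ E] [CompleteSpace E] {F : E → E} {x₀ : E} (hF : ContDiffAt ℝ 1 F x₀) :
    ∃ B : ℝ, ∀ᶠ h in nhdsWithin (0 : ℝ) (Ioi 0), ∃ v, v = x₀ + h • F v ∧ ‖v - x₀‖ ≤ B * h := by
  obtain ⟨K, t, ht, hLip⟩ := hF.exists_lipschitzOnWith
  obtain ⟨r, hr, hrt⟩ := Metric.nhds_basis_closedBall.mem_iff.mp ht
  have hLip' := hLip.mono hrt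
  have hx₀ : x₀ ∈ Metric.closedBall x₀ r := Metric.mem_closedBall_self hr.le
  have hbound : ∀ v ∈ Metric.closedBall x₀ r, ‖F v‖ ≤ ‖F x₀‖ + K * r := fun v hv => by
    have h₁ := hLip'.dist_le_mul v hv x₀ hx₀
    rw [dist_eq_norm] at h₁
    have h₂ : (K : ℝ) * dist v x₀ ≤ K * r :=
      mul_le_mul_of_nonneg_left (Metric.mem_closedBall.mp hv) K.2
    linarith [norm_le_norm_add_norm_sub (F x₀) (F v), norm_sub_rev (F x₀) (F v)]
  have hsmall : ∀ a b : ℝ, 0 < b → ∀ᶠ h in nhdsWithin (0 : ℝ) (Ioi 0), h * a < b := fun a b hb => by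
    refine nhdsWithin_le_nhds ((continuous_id.mul continuous_const).tendsto' (0 : ℝ) 0 ?_
      |>.eventually_lt_const hb)
    simp
  refine ⟨‖F x₀‖ + K * r, ?_⟩
  filter_upwards [hsmall (‖F x₀‖ + K * r) r hr, hsmall K 1 one_pos, self_mem_nhdsWithin]
    with h hB hK hh
  have hh : 0 < h := hh
  have hnorm : ∀ v ∈ Metric.closedBall x₀ r, ‖h • F v‖ ≤ (‖F x₀‖ + K * r) * h := fun v hv => by
    rw [norm_smul, Real.norm_of_nonneg hh.le, mul_comm]
    exact mul_le_mul_of_nonneg_right (hbound v hv) hh.le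
  have hmaps : MapsTo (fun v => x₀ + h • F v) (Metric.closedBall x₀ r) (Metric.closedBall x₀ r) :=
    fun v hv => by
      rw [Metric.mem_closedBall, dist_eq_norm, add_sub_cancel_left]
      linarith [hnorm v hv]
  have hcontr : ContractingWith (h.toNNReal * K) (hmaps.restrict _ _ _) := by
    refine ⟨?_, LipschitzWith.of_dist_le_mul fun v w => ?_⟩
    · rw [← NNReal.coe_lt_coe]
      simpa [hh.le] using hK
    · have := hLip'.dist_le_mul v v.2 w w.2
      simp only [Subtype.dist_eq, MapsTo.val_restrict_apply, dist_add_left, dist_smul₀,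
        Real.norm_of_nonneg hh.le, NNReal.coe_mul, Real.coe_toNNReal _ hh.le, mul_assoc]
      exact mul_le_mul_of_nonneg_left this hh.le
  obtain ⟨v, hv, hfix, -⟩ := hcontr.exists_fixedPoint' Metric.isClosed_closedBall.isComplete
    hmaps hx₀ (edist_ne_top _ _)
  have hfix : x₀ + h • F v = v := hfix
  refine ⟨v, hfix.symm, ?_⟩
  have : v - x₀ = h • F v := by rw [sub_eq_iff_eq_add', hfix]
  rw [this]
  exact hnorm v hv

theorem exists_solution_family_logarithmic_perturbation {ι : Type*} [Fintype ι] {κ : ι → ℝ}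
    (hκ : ∀ i, 0 < κ i) (b : ι → ℝ) (M : ι → ι → ℝ) (β γ : ℝ) :
    ∃ v : ℝ → ι → ℝ,
      (∀ᶠ h in nhdsWithin (0 : ℝ) (Ioi 0), ∀ i,
        v h i = κ i + h * (b i + ∑ j, M i j * v h j - v h i * (β * Real.log (v h i) + γ))) ∧
      ∀ i, (fun h => v h i - κ i) =O[nhdsWithin (0 : ℝ) (Ioi 0)] fun h => h := by
  have hF : ContDiffAt ℝ 1 (fun (v : ι → ℝ) i =>
      b i + ∑ j, M i j * v j - v i * (β * Real.log (v i) + γ)) κ := by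
    refine contDiffAt_pi.mpr fun i => ?_
    have hlog : ContDiffAt ℝ 1 (fun v : ι → ℝ => Real.log (v i)) κ :=
      (contDiffAt_apply ℝ ℝ i κ).log (hκ i).ne'
    fun_prop
  obtain ⟨B, hB⟩ := eventually_exists_eq_add_smul_of_contDiffAt hF
  obtain ⟨v, hv⟩ := hB.choice
  refine ⟨v, hv.mono fun h hh i => congrFun hh.1 i, ?_⟩
  rw [← Asymptotics.isBigO_pi (f := fun h i => v h i - κ i)]
  refine Asymptotics.IsBigO.of_bound B ?_
  filter_upwards [hv, self_mem_nhdsWithin] with h hh hpos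
  rw [Real.norm_of_nonneg (le_of_lt hpos)]
  exact hh.2

theorem tendsto_log_one_div_nhdsGT_zero :
    Tendsto (fun ε : ℝ => Real.log (1 / ε)) (nhdsWithin 0 (Ioi 0)) atTop := by
  simpa [Function.comp_def] using Real.tendsto_log_atTop.comp tendsto_inv_nhdsGT_zero

/-- The rescaled core radius satisfies the first family of equations of the system. -/
theorem rescaled_core_radius_equation {p R c ε L v : ℝ} (hp : 1 < p) (hR : 0 < R) (hc : 0 < c)
    (hε : 0 < ε) (hL : 0 < L) (hLε : L = Real.log (1 / ε)) (hv : 0 < v) :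
    (ε * (2 * π / L) ^ ((p - 1) / 2)) ^ (2 / (p - 1)) *
      (R * Real.exp (-(L + ((p - 1) / 2 * Real.log v +
        (p - 1) / 2 * Real.log (R ^ (2 / (p - 1)) / (2 * π * c)))))) ^ (-(2 / (p - 1))) * c
      = v / L := by
  have hp' : p - 1 ≠ 0 := by linarith
  have hpi := Real.pi_pos
  have hε' : ε = Real.exp (-L) := by
    rw [hLε, one_div, Real.log_inv, neg_neg, Real.exp_log hε]
  have h₁ : (ε * (2 * π / L) ^ ((p - 1) / 2)) ^ (2 / (p - 1)) =
      Real.exp (-L * (2 / (p - 1))) * (2 * π / L) := by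
    rw [Real.mul_rpow hε.le (by positivity), ← Real.rpow_mul (by positivity), hε',
      ← Real.exp_mul, show (p - 1) / 2 * (2 / (p - 1)) = 1 by field_simp, Real.rpow_one]
  have hK : 0 < R ^ (2 / (p - 1)) / (2 * π * c) := by positivity
  have h₂ : -(L + ((p - 1) / 2 * Real.log v +
        (p - 1) / 2 * Real.log (R ^ (2 / (p - 1)) / (2 * π * c)))) * (-(2 / (p - 1))) =
      L * (2 / (p - 1)) + Real.log v + Real.log (R ^ (2 / (p - 1)) / (2 * π * c)) := by
    field_simp
    ring
  rw [h₁, Real.mul_rpow hR.le (Real.exp_pos _).le, ← Real.exp_mul, h₂, Real.exp_add, Real.exp_add,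
    Real.exp_log hv, Real.exp_log hK, Real.rpow_neg hR.le, neg_mul, Real.exp_neg]
  have := Real.exp_pos (L * (2 / (p - 1)))
  have : 0 < R ^ (2 / (p - 1)) := by positivity
  field_simp

theorem exists_solution_family_of_coupled_system {ι : Type*} [Fintype ι] {p R c : ℝ}
    (hp : 1 < p) (hR : 0 < R) (hc : 0 < c) {κ : ι → ℝ} (hκ : ∀ i, 0 < κ i) (b : ι → ℝ)
    (M : ι → ι → ℝ) :
    ∃ s a : ℝ → ι → ℝ,
      (∀ᶠ ε in nhdsWithin (0 : ℝ) (Ioi 0), ∀ i, s ε i ∈ Ioo (0 : ℝ) R ∧ 0 < a ε i ∧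
        (ε * (2 * π / Real.log (1 / ε)) ^ ((p - 1) / 2)) ^ (2 / (p - 1)) *
          (s ε i) ^ (-(2 / (p - 1))) * c = a ε i / Real.log (R / s ε i) ∧
        a ε i = κ i + b i / Real.log (1 / ε) +
          ∑ j, M i j * (a ε j / Real.log (R / s ε j))) ∧
      (∀ i, (fun ε => 1 / Real.log (R / s ε i) - 1 / Real.log (R / ε))
        =O[nhdsWithin (0 : ℝ) (Ioi 0)] fun ε => 1 / Real.log (1 / ε) ^ 2) ∧
      (∀ i, (fun ε => a ε i - κ i)
        =O[nhdsWithin (0 : ℝ) (Ioi 0)] fun ε => 1 / Real.log (1 / ε)) ∧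
      ∀ i, Tendsto (fun ε => a ε i * Real.log (1 / ε) / Real.log (R / s ε i))
        (nhdsWithin 0 (Ioi 0)) (nhds (κ i)) := by
  obtain ⟨v₀, hv₀, hO₀⟩ := exists_solution_family_logarithmic_perturbation hκ b M ((p - 1) / 2)
    ((p - 1) / 2 * Real.log (R ^ (2 / (p - 1)) / (2 * π * c)))
  set γ := (p - 1) / 2 * Real.log (R ^ (2 / (p - 1)) / (2 * π * c)) with hγ
  have hLtop := tendsto_log_one_div_nhdsGT_zero
  have hLpos := hLtop.eventually_gt_atTop 0
  set L : ℝ → ℝ := fun ε => Real.log (1 / ε) with hL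
  have hinv : Tendsto (fun ε => (L ε)⁻¹) (nhdsWithin 0 (Ioi 0)) (nhdsWithin 0 (Ioi 0)) :=
    tendsto_inv_atTop_nhdsGT_zero.comp hLtop
  have hinv₀ := tendsto_nhds_of_tendsto_nhdsWithin hinv
  obtain ⟨v, hv⟩ : ∃ v : ℝ → ι → ℝ, v = fun ε => v₀ (L ε)⁻¹ := ⟨_, rfl⟩
  have hveq : ∀ᶠ ε in nhdsWithin (0 : ℝ) (Ioi 0), ∀ i, v ε i = κ i + (L ε)⁻¹ *
      (b i + ∑ j, M i j * v ε j - v ε i * ((p - 1) / 2 * Real.log (v ε i) + γ)) := by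
    rw [hv]; exact hinv.eventually hv₀
  have hvO : ∀ i, (fun ε => v ε i - κ i) =O[nhdsWithin (0 : ℝ) (Ioi 0)] fun ε => (L ε)⁻¹ := by
    rw [hv]; exact fun i => (hO₀ i).comp_tendsto hinv
  have hvlim : ∀ i, Tendsto (fun ε => v ε i) (nhdsWithin 0 (Ioi 0)) (nhds (κ i)) := fun i => by
    simpa using ((hvO i).trans_tendsto hinv₀).add_const (κ i)
  have hvpos : ∀ᶠ ε in nhdsWithin (0 : ℝ) (Ioi 0), ∀ i, 0 < v ε i :=
    eventually_all.mpr fun i => (hvlim i).eventually_const_lt (hκ i)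
  obtain ⟨e, he⟩ : ∃ e : ℝ → ι → ℝ, e = fun ε i => (p - 1) / 2 * Real.log (v ε i) + γ := ⟨_, rfl⟩
  have helim : ∀ i, Tendsto (fun ε => e ε i) (nhdsWithin 0 (Ioi 0))
      (nhds ((p - 1) / 2 * Real.log (κ i) + γ)) := fun i => by
    rw [he]
    exact (((hvlim i).log (hκ i).ne').const_mul _).add_const _
  have httop : ∀ i, Tendsto (fun ε => L ε + e ε i) (nhdsWithin 0 (Ioi 0)) atTop := fun i =>
    hLtop.atTop_add (helim i)
  have htpos : ∀ᶠ ε in nhdsWithin (0 : ℝ) (Ioi 0), ∀ i, 0 < L ε + e ε i :=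
    eventually_all.mpr fun i => (httop i).eventually_gt_atTop 0
  have hlog : ∀ ε i, Real.log (R / (R * Real.exp (-(L ε + e ε i)))) = L ε + e ε i := fun ε i => by
    rw [← div_div, div_self hR.ne', one_div, ← Real.exp_neg, neg_neg, Real.log_exp]
  have hratio : ∀ d : ℝ → ℝ, ∀ d₀, Tendsto d (nhdsWithin 0 (Ioi 0)) (nhds d₀) →
      Tendsto (fun ε => L ε / (L ε + d ε)) (nhdsWithin 0 (Ioi 0)) (nhds 1) := fun d d₀ hd => by
    have h₁ : Tendsto (fun ε => (1 + d ε * (L ε)⁻¹)⁻¹) (nhdsWithin 0 (Ioi 0)) (nhds 1) := by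
      simpa using ((hd.mul hinv₀).const_add 1).inv₀ (by simp)
    refine h₁.congr' ?_
    filter_upwards [hLpos] with ε hε
    have hε : L ε ≠ 0 := hε.ne'
    rw [← div_eq_mul_inv, one_add_div hε, inv_div]
  refine ⟨fun ε i => R * Real.exp (-(L ε + e ε i)), fun ε i => v ε i * (L ε + e ε i) / L ε,
    ?_, fun i => ?_, fun i => ?_, fun i => ?_⟩
  · filter_upwards [hveq, hvpos, htpos, hLpos, self_mem_nhdsWithin] with ε hε hv' ht hLε hε₀ i
    have hLε : 0 < L ε := hLε
    have hdiv : ∀ j, v ε j * (L ε + e ε j) / L ε / (L ε + e ε j) = v ε j / L ε := fun j => by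
      have := (ht j).ne'
      field_simp
    refine ⟨⟨by positivity, ?_⟩, ?_, ?_, ?_⟩
    · exact mul_lt_of_lt_one_right hR (Real.exp_lt_one_iff.mpr (neg_neg_of_pos (ht i)))
    · exact div_pos (mul_pos (hv' i) (ht i)) hLε
    · simp only [hlog, hdiv]
      rw [he, hγ]
      exact rescaled_core_radius_equation hp hR hc hε₀ hLε rfl (hv' i)
    · simp only [hlog, hdiv]
      have h₁ := hε i
      have h₂ : ∑ j, M i j * (v ε j / L ε) = (L ε)⁻¹ * ∑ j, M i j * v ε j := by
        rw [Finset.mul_sum]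
        exact Finset.sum_congr rfl fun j _ => by ring
      have h₃ : e ε i = (p - 1) / 2 * Real.log (v ε i) + γ := by rw [he]
      rw [h₂, mul_add, add_div, mul_div_cancel_right₀ _ hLε.ne']
      rw [← h₃] at h₁
      change _ = κ i + b i / L ε + _
      linear_combination h₁
  · simp only [hlog]
    have h₁ : Tendsto (fun ε => (Real.log R - e ε i) * (L ε / (L ε + e ε i)) *
        (L ε / (L ε + Real.log R))) (nhdsWithin 0 (Ioi 0)) (nhds _) :=
      (((helim i).const_sub _).mul (hratio _ _ (helim i))).mul (hratio _ _ tendsto_const_nhds)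
    have h₂ := (h₁.isBigO_one ℝ).mul (Asymptotics.isBigO_refl (fun ε => 1 / L ε ^ 2) _)
    simp only [one_mul] at h₂
    refine Asymptotics.IsBigO.congr' h₂ ?_ EventuallyEq.rfl
    filter_upwards [htpos, hLpos, (hLtop.atTop_add
      (tendsto_const_nhds (x := Real.log R))).eventually_gt_atTop 0, self_mem_nhdsWithin]
      with ε ht hLε hLR hε₀
    have hLε : L ε ≠ 0 := hLε.ne'
    have ht := (ht i).ne'
    have h₃ : Real.log (R / ε) = L ε + Real.log R := by
      have hε₀ : 0 < ε := hε₀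
      rw [hL, div_eq_mul_one_div, Real.log_mul hR.ne' (by positivity), add_comm]
    have hLR := hLR.ne'
    rw [h₃]
    field_simp
    ring
  · have h₁ := (((hvlim i).mul (helim i)).isBigO_one ℝ).mul
      (Asymptotics.isBigO_refl (fun ε => (L ε)⁻¹) _)
    simp only [one_mul] at h₁
    have h₂ := (hvO i).add h₁
    simp only [← one_div] at h₂
    refine h₂.congr' ?_ EventuallyEq.rfl
    filter_upwards [hLpos] with ε hLε
    have hLε : L ε ≠ 0 := hLε.ne'
    field_simp
    ring
  · refine (hvlim i).congr' ?_
    filter_upwards [htpos, hLpos] with ε ht hLε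
    have hLε : L ε ≠ 0 := hLε.ne'
    have ht := (ht i).ne'
    rw [hlog]
    change _ = _ * L ε / _
    field_simp

theorem exists_common_bound_of_isBigO {ι α : Type*} [Finite ι] {l : Filter α}
    {f : ι → α → ℝ} {g : α → ℝ} (hfg : ∀ i, f i =O[l] g) :
    ∃ B : ℝ, ∀ᶠ x in l, ∀ i, |f i x| ≤ B * |g x| := by
  have := Fintype.ofFinite ι
  obtain ⟨B, hB⟩ := (Asymptotics.isBigO_pi (f := fun x i => f i x).mpr hfg).bound
  exact ⟨B, hB.mono fun x hx i => (norm_le_pi_norm (fun i => f i x) i).trans hx⟩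

/-- Lemma 2.1 together with the asymptotic expansions of Remark 2.2,
at a fixed configuration. There exist `ε₀ ∈ (0,1/e)`, `C > 0` and solution families
`s_i^±(ε) ∈ (0,R)`, `a_i^±(ε) > 0` of the system (S) satisfying for `ε ∈ (0,ε₀)` the
bounds `|1/log(R/s_i^±) - 1/log(R/ε)| ≤ C log log(1/ε)/(log(1/ε))²` and
`|a_i^± - κ_i^±| ≤ C/log(1/ε)`; consequently `a_i^± log(1/ε)/log(R/s_i^±) → κ_i^±`
as `ε → 0⁺`. -/
theorem exists_solution_system_S_with_asymptotics (m n : ℕ) (hm : 1 ≤ m) (hn : 1 ≤ n)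
    (p R c : ℝ) (hp : 1 < p) (hR : 0 < R) (hc : 0 < c)
    (κp : Fin m → ℝ) (κm : Fin n → ℝ)
    (hκp : ∀ i, 0 < κp i) (hκm : ∀ j, 0 < κm j)
    (qp gp : Fin m → ℝ) (qm gm : Fin n → ℝ)
    (A : Fin m → Fin m → ℝ) (B : Fin n → Fin n → ℝ)
    (C : Fin m → Fin n → ℝ) (D : Fin n → Fin m → ℝ) :
    ∃ ε₀ ∈ Ioo (0 : ℝ) (1 / Real.exp 1), ∃ C₀ > (0 : ℝ),
      ∃ (sp : ℝ → Fin m → ℝ) (sm : ℝ → Fin n → ℝ)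
        (ap : ℝ → Fin m → ℝ) (am : ℝ → Fin n → ℝ),
        (∀ ε ∈ Ioo (0 : ℝ) ε₀,
          (∀ i, sp ε i ∈ Ioo (0 : ℝ) R) ∧ (∀ j, sm ε j ∈ Ioo (0 : ℝ) R) ∧
          (∀ i, 0 < ap ε i) ∧ (∀ j, 0 < am ε j) ∧
          (∀ i, (ε * (2 * π / Real.log (1 / ε)) ^ ((p - 1) / 2)) ^ (2 / (p - 1)) *
              (sp ε i) ^ (-(2 / (p - 1))) * c = ap ε i / Real.log (R / sp ε i)) ∧
          (∀ j, (ε * (2 * π / Real.log (1 / ε)) ^ ((p - 1) / 2)) ^ (2 / (p - 1)) *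
              (sm ε j) ^ (-(2 / (p - 1))) * c = am ε j / Real.log (R / sm ε j)) ∧
          (∀ i, ap ε i = κp i + 2 * π * qp i / Real.log (1 / ε)
              + gp i * ap ε i / Real.log (R / sp ε i)
              - ∑ k ∈ Finset.univ.erase i, A i k * ap ε k / Real.log (R / sp ε k)
              + ∑ l, C i l * am ε l / Real.log (R / sm ε l)) ∧
          (∀ j, am ε j = κm j - 2 * π * qm j / Real.log (1 / ε)
              + gm j * am ε j / Real.log (R / sm ε j)
              - ∑ l ∈ Finset.univ.erase j, B j l * am ε l / Real.log (R / sm ε l)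
              + ∑ k, D j k * ap ε k / Real.log (R / sp ε k)) ∧
          (∀ i, |1 / Real.log (R / sp ε i) - 1 / Real.log (R / ε)| ≤
              C₀ * Real.log (Real.log (1 / ε)) / (Real.log (1 / ε)) ^ 2) ∧
          (∀ j, |1 / Real.log (R / sm ε j) - 1 / Real.log (R / ε)| ≤
              C₀ * Real.log (Real.log (1 / ε)) / (Real.log (1 / ε)) ^ 2) ∧
          (∀ i, |ap ε i - κp i| ≤ C₀ / Real.log (1 / ε)) ∧
          (∀ j, |am ε j - κm j| ≤ C₀ / Real.log (1 / ε))) ∧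
        (∀ i, Tendsto (fun ε : ℝ => ap ε i * Real.log (1 / ε) / Real.log (R / sp ε i))
            (nhdsWithin 0 (Ioi 0)) (nhds (κp i))) ∧
        (∀ j, Tendsto (fun ε : ℝ => am ε j * Real.log (1 / ε) / Real.log (R / sm ε j))
            (nhdsWithin 0 (Ioi 0)) (nhds (κm j))) := by
  obtain ⟨s, a, hsys, hs, ha, hlim⟩ := exists_solution_family_of_coupled_system hp hR hc
    (κ := Sum.elim κp κm) (by rintro (i | j) <;> simp [hκp, hκm])
    (Sum.elim (fun i => 2 * π * qp i) fun j => -(2 * π * qm j))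
    (Sum.elim (fun i => Sum.elim (fun k => if k = i then gp i else -A i k) (C i))
      fun j => Sum.elim (D j) fun l => if l = j then gm j else -B j l)
  obtain ⟨B₁, hB₁⟩ := exists_common_bound_of_isBigO hs
  obtain ⟨B₂, hB₂⟩ := exists_common_bound_of_isBigO ha
  have hloglog := (Real.tendsto_log_atTop.comp tendsto_log_one_div_nhdsGT_zero).eventually_ge_atTop 1
  have hall := hsys.and (hB₁.and (hB₂.and (hloglog.and
    (tendsto_log_one_div_nhdsGT_zero.eventually_gt_atTop 0))))
  obtain ⟨ε₁, hε₁, hsub⟩ := mem_nhdsGT_iff_exists_Ioo_subset.mp hall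
  have hexp : 0 < 1 / Real.exp 1 := by positivity
  have hsum : ∀ {N : ℕ} (i : Fin N) (g : ℝ) (w x y : Fin N → ℝ),
      ∑ k, (if k = i then g else -w k) * (x k / y k) =
        g * x i / y i - ∑ k ∈ Finset.univ.erase i, w k * x k / y k := fun i g w x y => by
    rw [← Finset.add_sum_erase _ _ (Finset.mem_univ i), if_pos rfl, sub_eq_add_neg,
      ← Finset.sum_neg_distrib, mul_div_assoc]
    congr 1
    refine Finset.sum_congr rfl fun k hk => ?_
    rw [if_neg (Finset.ne_of_mem_erase hk)]
    ring
  refine ⟨min ε₁ (1 / Real.exp 1 / 2), ⟨lt_min hε₁ (half_pos hexp),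
    (min_le_right _ _).trans_lt (half_lt_self hexp)⟩, max 1 (max B₁ B₂),
    zero_lt_one.trans_le (le_max_left _ _),
    fun ε i => s ε (Sum.inl i), fun ε j => s ε (Sum.inr j),
    fun ε i => a ε (Sum.inl i), fun ε j => a ε (Sum.inr j), fun ε hε => ?_,
    fun i => hlim (Sum.inl i), fun j => hlim (Sum.inr j)⟩
  obtain ⟨h, h₁, h₂, hll, hL⟩ := hsub ⟨hε.1, hε.2.trans_le (min_le_left _ _)⟩
  have hll : 1 ≤ Real.log (Real.log (1 / ε)) := hll
  have hC : 0 ≤ max 1 (max B₁ B₂) := zero_le_one.trans (le_max_left _ _)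
  have hs' : ∀ i, |1 / Real.log (R / s ε i) - 1 / Real.log (R / ε)| ≤
      max 1 (max B₁ B₂) * Real.log (Real.log (1 / ε)) / (Real.log (1 / ε)) ^ 2 := fun i => by
    refine (h₁ i).trans ?_
    rw [abs_of_pos (by positivity), mul_one_div]
    gcongr
    exact ((le_max_left _ _).trans (le_max_right _ _)).trans (le_mul_of_one_le_right hC hll)
  have ha' : ∀ i, |a ε i - Sum.elim κp κm i| ≤ max 1 (max B₁ B₂) / Real.log (1 / ε) := fun i => by
    refine (h₂ i).trans ?_
    rw [abs_of_pos (by positivity), mul_one_div]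
    gcongr
    exact (le_max_right _ _).trans (le_max_right _ _)
  refine ⟨fun i => (h (Sum.inl i)).1, fun j => (h (Sum.inr j)).1, fun i => (h (Sum.inl i)).2.1,
    fun j => (h (Sum.inr j)).2.1, fun i => (h (Sum.inl i)).2.2.1,
    fun j => (h (Sum.inr j)).2.2.1, fun i => ?_, fun j => ?_, fun i => hs' _, fun j => hs' _,
    fun i => ha' (Sum.inl i), fun j => ha' (Sum.inr j)⟩
  · have h₃ := (h (Sum.inl i)).2.2.2
    simp only [Fintype.sum_sum_type, Sum.elim_inl, Sum.elim_inr, hsum] at h₃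
    simp only [mul_div_assoc] at h₃ ⊢
    linear_combination h₃
  · have h₃ := (h (Sum.inr j)).2.2.2
    simp only [Fintype.sum_sum_type, Sum.elim_inl, Sum.elim_inr, hsum] at h₃
    simp only [mul_div_assoc, neg_div] at h₃ ⊢
    linear_combination h₃
end

section
/- Let $p>1$, $R>0$, $a>0$ and $c>0$, and for each $\delta>0$ let $s_\delta\in(0,R)$ be the unique solution of $\delta^{2/(p-1)}\,s_\delta^{-2/(p-1)}\,c\,\ln(R/s_\delta)=a$. Then $\dfrac{s_\delta}{\delta\,|\ln\delta|^{(p-1)/2}}\longrightarrow \Bigl(\dfrac{c}{a}\Bigr)^{(p-1)/2}$ as $\delta\to 0^+$. -/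
open Real Set Filter

/-- Taking logarithms in `δ ^ (2 / (p - 1)) * x ^ (-(2 / (p - 1))) * c * log (R / x) = a`. -/
lemma neg_log_eq_of_free_boundary {p R a c δ x : ℝ} (hp : 1 < p) (hc : 0 < c) (hδ : 0 < δ)
    (hx : x ∈ Ioo (0 : ℝ) R)
    (h : δ ^ (2 / (p - 1)) * x ^ (-(2 / (p - 1))) * c * Real.log (R / x) = a) :
    -Real.log δ = Real.log (R / x) + ((p - 1) / 2 * Real.log (c / a) - Real.log R)
      + (p - 1) / 2 * Real.log (Real.log (R / x)) := by
  have hx0 : 0 < x := hx.1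
  have hR : 0 < R := hx0.trans hx.2
  have hL : 0 < Real.log (R / x) := Real.log_pos ((one_lt_div hx0).2 hx.2)
  have ha : 0 < a := by rw [← h]; positivity
  have hlog := congrArg Real.log h
  rw [Real.log_mul (by positivity) hL.ne', Real.log_mul (by positivity) hc.ne',
    Real.log_mul (by positivity) (by positivity), Real.log_rpow hδ, Real.log_rpow hx0] at hlog
  have hp' : p - 1 ≠ 0 := by linarith
  have hpr : (p - 1) / 2 * (2 / (p - 1)) = 1 := by field_simp
  rw [Real.log_div hc.ne' ha.ne']
  have hRx : Real.log (R / x) = Real.log R - Real.log x := Real.log_div hR.ne' hx0.ne'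
  linear_combination -((p - 1) / 2) * hlog - hRx + (Real.log δ - Real.log x) * hpr

/-- Solving `δ ^ (2 / (p - 1)) * x ^ (-(2 / (p - 1))) * c * log (R / x) = a` for the factor `x`
outside the logarithm. -/
lemma eq_mul_rpow_of_free_boundary {p R a c δ x : ℝ} (hp : 1 < p) (ha : 0 < a) (hc : 0 < c)
    (hδ : 0 < δ) (hx : x ∈ Ioo (0 : ℝ) R)
    (h : δ ^ (2 / (p - 1)) * x ^ (-(2 / (p - 1))) * c * Real.log (R / x) = a) :
    x = δ * ((c / a) ^ ((p - 1) / 2) * Real.log (R / x) ^ ((p - 1) / 2)) := by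
  have hx0 : 0 < x := hx.1
  have hR : 0 < R := hx0.trans hx.2
  have hL : 0 < Real.log (R / x) := Real.log_pos ((one_lt_div hx0).2 hx.2)
  apply Real.log_injOn_pos (mem_Ioi.2 hx0) (mem_Ioi.2 (by positivity))
  rw [Real.log_mul hδ.ne' (by positivity), Real.log_mul (by positivity) (by positivity),
    Real.log_rpow (by positivity), Real.log_rpow hL]
  have hRx : Real.log (R / x) = Real.log R - Real.log x := Real.log_div hR.ne' hx0.ne'
  linear_combination neg_log_eq_of_free_boundary hp hc hδ hx h + hRx

/-- If `f = L + K + r * log L` tends to infinity, with `L` positive and `0 ≤ r`, then `L ~ f`. -/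
lemma tendsto_div_of_eq_add_log {ι : Type*} {l : Filter ι} {f L : ι → ℝ} {K r : ℝ} (hr : 0 ≤ r)
    (hf : Tendsto f l atTop) (hL : ∀ᶠ i in l, 0 < L i)
    (h : ∀ᶠ i in l, f i = L i + K + r * Real.log (L i)) :
    Tendsto (fun i => L i / f i) l (nhds 1) := by
  have hLtop : Tendsto L l atTop := by
    have hlin : Tendsto (fun i => (f i + -K) / (1 + r)) l atTop :=
      (tendsto_atTop_add_const_right l (-K) hf).atTop_div_const (by positivity)
    refine tendsto_atTop_mono' l ?_ hlin
    filter_upwards [hL, h] with i hi hfi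
    rw [div_le_iff₀ (by positivity)]
    have := mul_le_mul_of_nonneg_left (Real.log_le_self hi.le) hr
    linarith
  have hlog : Tendsto (fun i => Real.log (L i) / L i) l (nhds 0) :=
    Real.isLittleO_log_id_atTop.tendsto_div_nhds_zero.comp hLtop
  have hinv : Tendsto (fun i => 1 + K / L i + r * (Real.log (L i) / L i)) l (nhds 1) := by
    simpa using (hLtop.const_div_atTop K).const_add 1 |>.add (hlog.const_mul r)
  have := hinv.inv₀ one_ne_zero
  rw [inv_one] at this
  refine this.congr' ?_
  filter_upwards [hL, h] with i hi hfi
  rw [hfi, ← inv_div]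
  field_simp

/-- If for each `δ > 0`, `s δ ∈ (0,R)` is the solution of
`δ^(2/(p-1)) * (s δ)^(-(2/(p-1))) * c * log (R / s δ) = a`, then
`s δ / (δ * |log δ|^((p-1)/2)) → (c/a)^((p-1)/2)` as `δ → 0⁺`. -/
theorem free_boundary_radius_asymptotics (p R a c : ℝ) (hp : 1 < p) (hR : 0 < R)
    (ha : 0 < a) (hc : 0 < c) (s : ℝ → ℝ)
    (hs : ∀ δ : ℝ, 0 < δ → s δ ∈ Ioo (0 : ℝ) R ∧
      δ ^ (2 / (p - 1)) * (s δ) ^ (-(2 / (p - 1))) * c * Real.log (R / s δ) = a) :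
    Tendsto (fun δ : ℝ => s δ / (δ * |Real.log δ| ^ ((p - 1) / 2)))
      (nhdsWithin 0 (Ioi 0)) (nhds ((c / a) ^ ((p - 1) / 2))) := by
  have hr : 0 < (p - 1) / 2 := by linarith
  have hpos : ∀ᶠ δ : ℝ in nhdsWithin 0 (Ioi 0), 0 < δ := self_mem_nhdsWithin
  have hL : ∀ δ : ℝ, 0 < δ → 0 < Real.log (R / s δ) := fun δ hδ =>
    Real.log_pos ((one_lt_div (hs δ hδ).1.1).2 (hs δ hδ).1.2)
  have htop : Tendsto (fun δ : ℝ => -Real.log δ) (nhdsWithin 0 (Ioi 0)) atTop :=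
    tendsto_neg_atBot_atTop.comp Real.tendsto_log_nhdsGT_zero
  have hratio : Tendsto (fun δ => Real.log (R / s δ) / -Real.log δ)
      (nhdsWithin 0 (Ioi 0)) (nhds 1) := by
    refine tendsto_div_of_eq_add_log hr.le htop (hpos.mono hL)
      (K := (p - 1) / 2 * Real.log (c / a) - Real.log R) (hpos.mono fun δ hδ => ?_)
    exact neg_log_eq_of_free_boundary hp hc hδ (hs δ hδ).1 (hs δ hδ).2
  have hlim := (hratio.rpow_const (p := (p - 1) / 2) (Or.inr hr.le)).const_mul
    ((c / a) ^ ((p - 1) / 2))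
  rw [Real.one_rpow, mul_one] at hlim
  refine hlim.congr' ?_
  filter_upwards [hpos, htop.eventually_gt_atTop 0] with δ hδ hlog
  rw [abs_of_neg (neg_pos.1 hlog), Real.div_rpow (hL δ hδ).le hlog.le, ← mul_div_assoc,
    ← mul_div_mul_left _ _ hδ.ne',
    ← eq_mul_rpow_of_free_boundary hp ha hc hδ (hs δ hδ).1 (hs δ hδ).2]
end

section
/- One has the Pohozaev identity $\displaystyle\int_{B_1(0)}\phi(|x|)^{p+1}\,dx=\frac{\pi(p+1)}{2}\,\phi'(1)^2$. -/
open Real Set MeasureTheory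

/-- Polar coordinates for a radial function on the unit disc. -/
theorem setIntegral_ball_fun_norm_eq (f : ℝ → ℝ) :
    (∫ x in Metric.ball (0 : EuclideanSpace ℝ (Fin 2)) 1, f ‖x‖)
      = 2 * π * ∫ r in (0 : ℝ)..1, r * f r := by
  have h : (∫ x in Metric.ball (0 : EuclideanSpace ℝ (Fin 2)) 1, f ‖x‖)
      = ∫ x : EuclideanSpace ℝ (Fin 2), (Iio (1 : ℝ)).indicator f ‖x‖ := by
    rw [← integral_indicator Metric.isOpen_ball.measurableSet]
    refine integral_congr_ae (Filter.Eventually.of_forall fun x => ?_)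
    simp [indicator]
  have hvol : (volume : Measure (EuclideanSpace ℝ (Fin 2))).real (Metric.ball 0 1) = π := by
    simp [Measure.real, EuclideanSpace.volume_ball_fin_two, pi_pos.le]
  have hind : ∀ y : ℝ, y * (Iio (1 : ℝ)).indicator f y
      = (Iio (1 : ℝ)).indicator (fun r => r * f r) y := fun y => by
    by_cases hy : y ∈ Iio (1 : ℝ) <;> simp [indicator, hy]
  rw [h, integral_fun_norm_addHaar, hvol, finrank_euclideanSpace_fin]
  simp only [Nat.add_one_sub_one, pow_one, smul_eq_mul, nsmul_eq_mul, Nat.cast_ofNat, hind]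
  rw [setIntegral_indicator measurableSet_Iio, Ioi_inter_Iio,
    intervalIntegral.integral_of_le zero_le_one, integral_Ioc_eq_integral_Ioo, mul_assoc]

/-- The derivative of the Pohozaev functional along a solution of the radial equation. -/
theorem hasDerivAt_pohozaev_functional {p r a b : ℝ} (hp : 0 < p + 1) {φ φ' : ℝ → ℝ}
    (hr : r ≠ 0) (hφ : HasDerivAt φ a r) (hφ' : HasDerivAt φ' b r) (ha : φ' r = a)
    (hpos : 0 < φ r) (hode : b + (1 / r) * a + φ r ^ p = 0) :
    HasDerivAt (fun s => s ^ 2 * φ' s ^ 2 / 2 + s ^ 2 * φ s ^ (p + 1) / (p + 1))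
      (2 / (p + 1) * (r * φ r ^ (p + 1))) r := by
  have hsq := hasDerivAt_pow 2 r
  have hpow := hφ.rpow_const (p := p + 1) (Or.inl hpos.ne')
  refine (((hsq.fun_mul (hφ'.fun_pow 2)).div_const 2).fun_add
    ((hsq.fun_mul hpow).div_const (p + 1))).congr_deriv ?_
  have hb : b = -(1 / r) * a - φ r ^ p := by linarith
  rw [add_sub_cancel_right, ha, hb]
  field_simp
  push_cast
  ring

/-- Pohozaev identity for the radial profile `φ` of the positive
solution of `-Δφ = φ^p` in the unit ball of `ℝ²` vanishing on the boundary: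
`∫_{B₁(0)} φ(|x|)^{p+1} dx = π(p+1)/2 * φ'(1)²`. -/
theorem pohozaev_identity (p : ℝ) (hp : 1 < p) (φ φ' φ'' : ℝ → ℝ)
    (hd1 : ∀ r ∈ Icc (0 : ℝ) 1, HasDerivWithinAt φ (φ' r) (Icc (0 : ℝ) 1) r)
    (hd1c : ContinuousOn φ' (Icc (0 : ℝ) 1))
    (hd2 : ∀ r ∈ Ioo (0 : ℝ) 1, HasDerivAt φ' (φ'' r) r)
    (hpos : ∀ r ∈ Ico (0 : ℝ) 1, 0 < φ r) (hφ1 : φ 1 = 0)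
    (hode : ∀ r ∈ Ioo (0 : ℝ) 1, φ'' r + (1 / r) * φ' r + φ r ^ p = 0) :
    (∫ x in Metric.ball (0 : EuclideanSpace ℝ (Fin 2)) 1, φ ‖x‖ ^ (p + 1))
      = π * (p + 1) / 2 * (φ' 1) ^ 2 := by
  have hp1 : 0 < p + 1 := by linarith
  have hφc : ContinuousOn φ (Icc 0 1) := fun r hr => (hd1 r hr).continuousWithinAt
  have hpow : ContinuousOn (fun r => φ r ^ (p + 1)) (Icc 0 1) :=
    hφc.rpow_const fun _ _ => Or.inr hp1.le
  have hint := intervalIntegral.integral_eq_sub_of_hasDerivAt_of_le zero_le_one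
    (f := fun s => s ^ 2 * φ' s ^ 2 / 2 + s ^ 2 * φ s ^ (p + 1) / (p + 1))
    (f' := fun r => 2 / (p + 1) * (r * φ r ^ (p + 1)))
    (by fun_prop)
    (fun r hr => hasDerivAt_pohozaev_functional hp1 hr.1.ne'
      ((hd1 r (Ioo_subset_Icc_self hr)).hasDerivAt (Icc_mem_nhds hr.1 hr.2)) (hd2 r hr) rfl
      (hpos r (Ioo_subset_Ico_self hr)) (hode r hr))
    (ContinuousOn.intervalIntegrable_of_Icc zero_le_one (by fun_prop))
  rw [intervalIntegral.integral_const_mul] at hint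
  simp only [hφ1, zero_rpow hp1.ne'] at hint
  rw [setIntegral_ball_fun_norm_eq fun r => φ r ^ (p + 1)]
  field_simp at hint ⊢
  linarith
end

section
/- The function $W$ is continuously differentiable on $[0,R]$ (in particular, the one-sided derivatives at $r=s$ coincide), satisfies $W(R)=0$, $W(r)>a$ for $0\le r<s$, $W(r)\le a$ for $s\le r\le R$, and solves $-\delta^2\bigl(W''(r)+\tfrac{1}{r}W'(r)\bigr)=\max(W(r)-a,0)^{p}$ for every $r\in(0,R)\setminus\{s\}$. -/
open Real Set MeasureTheory

/-- Under `r ↦ c * f (r / s)` with amplitude `c = δ ^ (2 / (p - 1)) * s ^ (-(2 / (p - 1)))`,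
the power nonlinearity rescales by `c ^ p = δ ^ 2 * c / s ^ 2`. -/
lemma scaling_amplitude_rpow {p δ s : ℝ} (hp : 1 < p) (hδ : 0 < δ) (hs : 0 < s) :
    (δ ^ (2 / (p - 1)) * s ^ (-(2 / (p - 1)))) ^ p =
      δ ^ 2 * (δ ^ (2 / (p - 1)) * s ^ (-(2 / (p - 1)))) / s ^ 2 := by
  have hp' : p - 1 ≠ 0 := by linarith
  have e1 : 2 / (p - 1) * p = 2 / (p - 1) + 2 := by field_simp; ring
  have e2 : -(2 / (p - 1)) * p = -(2 / (p - 1)) - 2 := by linear_combination -e1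
  rw [mul_rpow (by positivity) (by positivity), ← rpow_mul hδ.le, ← rpow_mul hs.le, e1, e2,
    rpow_add hδ, rpow_sub hs, rpow_two, rpow_two]
  ring

/-- The radial profile `W` of the regularized vortex `W_{δ,a}` is
continuously differentiable on `[0,R]` (in particular the one-sided derivatives at
`r = s` coincide), satisfies `W(R) = 0`, `W > a` on `[0,s)`, `W ≤ a` on `[s,R]`,
and solves `-δ²(W'' + W'/r) = (W - a)₊^p` for every `r ∈ (0,R) \ {s}`. -/
theorem vortex_profile_properties (p : ℝ) (hp : 1 < p) (φ φ' φ'' : ℝ → ℝ)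
    (hd1 : ∀ r ∈ Icc (0 : ℝ) 1, HasDerivWithinAt φ (φ' r) (Icc (0 : ℝ) 1) r)
    (hd1c : ContinuousOn φ' (Icc (0 : ℝ) 1))
    (hd2 : ∀ r ∈ Ioo (0 : ℝ) 1, HasDerivAt φ' (φ'' r) r)
    (hpos : ∀ r ∈ Ico (0 : ℝ) 1, 0 < φ r) (hφ1 : φ 1 = 0)
    (hode : ∀ r ∈ Ioo (0 : ℝ) 1, φ'' r + (1 / r) * φ' r + φ r ^ p = 0)
    (R δ a s : ℝ) (hR : 0 < R) (hδ : 0 < δ) (ha : 0 < a) (hs : s ∈ Ioo (0 : ℝ) R)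
    (hmatch : δ ^ (2 / (p - 1)) * s ^ (-(2 / (p - 1))) * φ' 1 = a / Real.log (s / R))
    (W : ℝ → ℝ)
    (hW : ∀ r : ℝ, W r =
      if r ≤ s then a + δ ^ (2 / (p - 1)) * s ^ (-(2 / (p - 1))) * φ (r / s)
      else a * Real.log (r / R) / Real.log (s / R)) :
    ∃ W' : ℝ → ℝ,
      (∀ r ∈ Icc (0 : ℝ) R, HasDerivWithinAt W (W' r) (Icc (0 : ℝ) R) r) ∧
      ContinuousOn W' (Icc (0 : ℝ) R) ∧
      W R = 0 ∧
      (∀ r ∈ Ico (0 : ℝ) s, a < W r) ∧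
      (∀ r ∈ Icc s R, W r ≤ a) ∧
      (∀ r ∈ Ioo (0 : ℝ) R, r ≠ s → ∃ W''r : ℝ,
        HasDerivAt W' W''r r ∧
        -δ ^ 2 * (W''r + (1 / r) * W' r) = max (W r - a) 0 ^ p) := by
  obtain ⟨hs0, hsR⟩ := hs
  have hL : Real.log (s / R) < 0 := Real.log_neg (by positivity) ((div_lt_one hR).2 hsR)
  have hcp := scaling_amplitude_rpow hp hδ hs0
  have hc : 0 < δ ^ (2 / (p - 1)) * s ^ (-(2 / (p - 1))) := by positivity
  set c := δ ^ (2 / (p - 1)) * s ^ (-(2 / (p - 1)))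
  set L := Real.log (s / R)
  have hWin : ∀ r ≤ s, W r = a + c * φ (r / s) := fun r hr => by rw [hW, if_pos hr]
  have hWs : W s = a := by rw [hWin s le_rfl, div_self hs0.ne', hφ1]; ring
  have hWout : ∀ r, s ≤ r → W r = a * Real.log (r / R) / L := fun r hr => by
    rcases hr.eq_or_lt with rfl | h
    · rw [hWs]; exact (mul_div_cancel_right₀ a hL.ne).symm
    · rw [hW, if_neg h.not_ge]
  have hWle : ∀ r, s ≤ r → W r ≤ a := fun r hr => by
    rw [hWout r hr, div_le_iff_of_neg hL]
    exact mul_le_mul_of_nonneg_left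
      (Real.log_le_log (by positivity) (div_le_div_of_nonneg_right hr hR.le)) ha.le
  set W' : ℝ → ℝ := fun r => if r ≤ s then c / s * φ' (r / s) else a / (r * L)
  have hW'in : ∀ r ≤ s, W' r = c / s * φ' (r / s) := fun r hr => if_pos hr
  have hW'out : ∀ r, s ≤ r → W' r = a / (r * L) := fun r hr => by
    rcases hr.eq_or_lt with rfl | h
    · rw [hW'in s le_rfl, div_self hs0.ne', div_mul_eq_mul_div, hmatch, div_div, mul_comm L]
    · exact if_neg h.not_ge
  have hmaps : MapsTo (fun r : ℝ => r / s) (Icc 0 s) (Icc 0 1) := fun r hr =>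
    ⟨div_nonneg hr.1 hs0.le, (div_le_one hs0).2 hr.2⟩
  have hdin : ∀ r ∈ Icc 0 s, HasDerivWithinAt W (W' r) (Icc 0 s) r := fun r hr => by
    have h := (((hd1 (r / s) (hmaps hr)).scomp r
      ((hasDerivWithinAt_id r (Icc 0 s)).div_const s) hmaps).const_mul c).const_add a
    rw [hW'in r hr.2]
    refine (h.congr (fun x hx => hWin x hx.2) (hWin r hr.2)).congr_deriv ?_
    simp only [smul_eq_mul]
    ring
  have hdout : ∀ r ∈ Icc s R, HasDerivWithinAt W (W' r) (Icc s R) r := fun r hr => by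
    have hr0 : 0 < r := hs0.trans_le hr.1
    have h := ((((hasDerivAt_id r).div_const R).log (div_pos hr0 hR).ne').const_mul
      a).div_const L |>.hasDerivWithinAt (s := Icc s R)
    rw [hW'out r hr.1]
    refine (h.congr (fun x hx => hWout x hx.1) (hWout r hr.1)).congr_deriv ?_
    simp only [id]
    field_simp
  have hunion : Icc 0 s ∪ Icc s R = Icc 0 R := Icc_union_Icc_eq_Icc hs0.le hsR.le
  refine ⟨W', fun r hr => ?_, ?_, ?_, fun r hr => ?_, fun r hr => ?_, fun r hr hrs => ?_⟩
  · rw [← hunion]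
    refine HasDerivWithinAt.union ?_ ?_
    · by_cases h : r ∈ Icc 0 s
      · exact hdin r h
      · exact hasDerivWithinAt_iff_hasFDerivWithinAt.2
          (.of_notMem_closure (by rwa [isClosed_Icc.closure_eq]))
    · by_cases h : r ∈ Icc s R
      · exact hdout r h
      · exact hasDerivWithinAt_iff_hasFDerivWithinAt.2
          (.of_notMem_closure (by rwa [isClosed_Icc.closure_eq]))
  · rw [← hunion]
    refine ContinuousOn.union_of_isClosed ?_ ?_ isClosed_Icc isClosed_Icc
    · refine ContinuousOn.congr ?_ fun r hr => hW'in r hr.2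
      exact continuousOn_const.mul (hd1c.comp (by fun_prop) hmaps)
    · refine ContinuousOn.congr ?_ fun r hr => hW'out r hr.1
      exact continuousOn_const.div (by fun_prop)
        fun r hr => mul_ne_zero (hs0.trans_le hr.1).ne' hL.ne
  · rw [hWout R hsR.le, div_self hR.ne']; simp
  · rw [hWin r hr.2.le]
    have := hpos (r / s) ⟨div_nonneg hr.1 hs0.le, (div_lt_one hs0).2 hr.2⟩
    exact lt_add_of_pos_right a (mul_pos hc this)
  · exact hWle r hr.1
  · have hr0 := hr.1
    rcases hrs.lt_or_gt with h | h
    · have hrs' : r / s ∈ Ioo (0 : ℝ) 1 := ⟨div_pos hr0 hs0, (div_lt_one hs0).2 h⟩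
      have hφ := hpos (r / s) ⟨hrs'.1.le, hrs'.2⟩
      refine ⟨c / s ^ 2 * φ'' (r / s), ?_, ?_⟩
      · have hd := ((hd2 (r / s) hrs').scomp r ((hasDerivAt_id r).div_const s)).const_mul (c / s)
        refine (hd.congr_of_eventuallyEq ?_).congr_deriv ?_
        · filter_upwards [Iio_mem_nhds h] with x hx using hW'in x (le_of_lt hx)
        · simp only [smul_eq_mul]
          field_simp
      · rw [hWin r h.le, hW'in r h.le, add_sub_cancel_left, max_eq_left (by positivity),
          mul_rpow hc.le hφ.le, hcp]
        have hode' := hode (r / s) hrs'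
        have e : φ (r / s) ^ p = -(φ'' (r / s) + 1 / (r / s) * φ' (r / s)) := by linarith
        rw [e]
        field_simp
    · refine ⟨-(a / (r ^ 2 * L)), ?_, ?_⟩
      · have hd := (hasDerivAt_inv hr0.ne').const_mul (a / L)
        refine (hd.congr_of_eventuallyEq ?_).congr_deriv ?_
        · filter_upwards [Ioi_mem_nhds h] with x hx
          rw [hW'out x (le_of_lt hx), div_eq_mul_inv a (x * L), mul_inv]
          ring
        · field_simp
      · rw [max_eq_right (sub_nonpos.2 (hWle r h.le)), zero_rpow (by linarith), hW'out r h.le]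
        field_simp
        ring
end

section
/- Define $w\colon(0,\infty)\to\mathbb{R}$ by $w(r)=\phi(r)$ for $0<r\le 1$ and $w(r)=\phi'(1)\ln r$ for $r>1$. Then $w$ is continuously differentiable on $(0,\infty)$, $w(r)<0$ for every $r>1$, $w$ is twice differentiable at every point of $(0,\infty)$ (including $r=1$), and $w''(r)+\tfrac{1}{r}w'(r)+\max(w(r),0)^{p}=0$ for every $r\in(0,\infty)$. -/
open Real Set MeasureTheory

open Filter Topology

/-- Gluing two functions at `a` preserves differentiability when values and one-sided derivatives
agree. -/
theorem hasDerivAt_ite_le_self {f g : ℝ → ℝ} {a e : ℝ} (hf : HasDerivWithinAt f e (Iic a) a)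
    (hg : HasDerivWithinAt g e (Ici a) a) (hfg : f a = g a) :
    HasDerivAt (fun r => if r ≤ a then f r else g r) e a := by
  rw [← hasDerivWithinAt_univ, ← Iic_union_Ici (a := a)]
  refine HasDerivWithinAt.union (hf.congr (fun x hx => if_pos hx) (if_pos le_rfl))
    (hg.congr (fun x hx => ?_) (by simp [hfg]))
  rcases (mem_Ici.1 hx).eq_or_lt with rfl | h
  · simp [hfg]
  · simp [not_le.2 h]

theorem hasDerivAt_ite_le_of_lt {f g : ℝ → ℝ} {a e r : ℝ} (hf : HasDerivAt f e r) (hr : r < a) :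
    HasDerivAt (fun r => if r ≤ a then f r else g r) e r := by
  refine hf.congr_of_eventuallyEq ?_
  filter_upwards [Iio_mem_nhds hr] with x hx
  exact if_pos hx.le

theorem hasDerivAt_ite_le_of_gt {f g : ℝ → ℝ} {a e r : ℝ} (hg : HasDerivAt g e r) (hr : a < r) :
    HasDerivAt (fun r => if r ≤ a then f r else g r) e r := by
  refine hg.congr_of_eventuallyEq ?_
  filter_upwards [Ioi_mem_nhds hr] with x hx
  exact if_neg (not_le.2 hx)

/-- The equation determines the left derivative of `φ'` at the boundary. -/
theorem hasDerivWithinAt_Iic_one_of_radial_ode {p : ℝ} (hp : 0 < p) {φ φ' φ'' : ℝ → ℝ}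
    (hφ : ContinuousOn φ (Icc (0 : ℝ) 1)) (hφ' : ContinuousOn φ' (Icc (0 : ℝ) 1))
    (hd : ∀ r ∈ Ioo (0 : ℝ) 1, HasDerivAt φ' (φ'' r) r) (hφ1 : φ 1 = 0)
    (hode : ∀ r ∈ Ioo (0 : ℝ) 1, φ'' r + (1 / r) * φ' r + φ r ^ p = 0) :
    HasDerivWithinAt φ' (-φ' 1) (Iic 1) 1 := by
  have hone : (1 : ℝ) ∈ Icc (0 : ℝ) 1 := by simp
  have hnhds : Ioo (0 : ℝ) 1 ∈ 𝓝[<] (1 : ℝ) := Ioo_mem_nhdsLT one_pos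
  have hle : 𝓝[<] (1 : ℝ) ≤ 𝓝[Icc (0 : ℝ) 1] 1 := by
    rw [← nhdsWithin_Ioo_eq_nhdsLT (zero_lt_one (α := ℝ))]
    exact nhdsWithin_mono _ Ioo_subset_Icc_self
  refine hasDerivWithinAt_Iic_of_tendsto_deriv (s := Ioo 0 1)
    (fun r hr => (hd r hr).differentiableAt.differentiableWithinAt)
    ((hφ' 1 hone).mono Ioo_subset_Icc_self) hnhds ?_
  have hlim : Tendsto (fun r : ℝ => -((1 / r) * φ' r + φ r ^ p)) (𝓝[<] 1) (𝓝 (-φ' 1)) := by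
    have hinv : Tendsto (fun r : ℝ => 1 / r) (𝓝[<] 1) (𝓝 (1 / 1)) :=
      (tendsto_const_nhds.div tendsto_id one_ne_zero).mono_left nhdsWithin_le_nhds
    have hpow := ((hφ 1 hone).tendsto.mono_left hle).rpow_const (p := p) (Or.inr hp.le)
    simpa [hφ1, Real.zero_rpow hp.ne'] using
      ((hinv.mul ((hφ' 1 hone).tendsto.mono_left hle)).add hpow).neg
  refine hlim.congr' ?_
  filter_upwards [hnhds] with r hr
  rw [(hd r hr).deriv]
  linarith [hode r hr]

/-- The radial profile `w` of the limit problem, defined by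
`w(r) = φ(r)` for `0 < r ≤ 1` and `w(r) = φ'(1) log r` for `r > 1`, is
continuously differentiable on `(0,∞)`, negative on `(1,∞)`, twice differentiable
at every point of `(0,∞)` (including `r = 1`), and satisfies
`w'' + w'/r + (w)₊^p = 0` on `(0,∞)`. -/
theorem limit_profile_properties (p : ℝ) (hp : 1 < p) (φ φ' φ'' : ℝ → ℝ)
    (hd1 : ∀ r ∈ Icc (0 : ℝ) 1, HasDerivWithinAt φ (φ' r) (Icc (0 : ℝ) 1) r)
    (hd1c : ContinuousOn φ' (Icc (0 : ℝ) 1))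
    (hd2 : ∀ r ∈ Ioo (0 : ℝ) 1, HasDerivAt φ' (φ'' r) r)
    (hpos : ∀ r ∈ Ico (0 : ℝ) 1, 0 < φ r) (hφ1 : φ 1 = 0) (hφ'1 : φ' 1 < 0)
    (hode : ∀ r ∈ Ioo (0 : ℝ) 1, φ'' r + (1 / r) * φ' r + φ r ^ p = 0)
    (w : ℝ → ℝ)
    (hw : ∀ r : ℝ, w r = if r ≤ 1 then φ r else φ' 1 * Real.log r) :
    ∃ w' : ℝ → ℝ,
      (∀ r ∈ Ioi (0 : ℝ), HasDerivAt w (w' r) r) ∧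
      ContinuousOn w' (Ioi (0 : ℝ)) ∧
      (∀ r : ℝ, 1 < r → w r < 0) ∧
      (∀ r ∈ Ioi (0 : ℝ), ∃ w''r : ℝ,
        HasDerivAt w' w''r r ∧
        w''r + (1 / r) * w' r + max (w r) 0 ^ p = 0) := by
  have hp0 : 0 < p := one_pos.trans hp
  obtain rfl : w = fun r => if r ≤ 1 then φ r else φ' 1 * Real.log r := funext hw
  have hneg : ∀ r : ℝ, 1 < r → (if r ≤ 1 then φ r else φ' 1 * Real.log r) < 0 := fun r hr => by
    rw [if_neg (not_le.2 hr)]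
    exact mul_neg_of_neg_of_pos hφ'1 (Real.log_pos hr)
  have hlog : ∀ r : ℝ, 0 < r → HasDerivAt (fun r => φ' 1 * Real.log r) (φ' 1 * r⁻¹) r :=
    fun r hr => (Real.hasDerivAt_log hr.ne').const_mul _
  have hinv : ∀ r : ℝ, 0 < r → HasDerivAt (fun r => φ' 1 * r⁻¹) (φ' 1 * -(r ^ 2)⁻¹) r :=
    fun r hr => (hasDerivAt_inv hr.ne').const_mul _
  have hsecond : ∀ r ∈ Ioi (0 : ℝ), ∃ w''r : ℝ,
      HasDerivAt (fun r => if r ≤ 1 then φ' r else φ' 1 * r⁻¹) w''r r ∧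
      w''r + (1 / r) * (if r ≤ 1 then φ' r else φ' 1 * r⁻¹) +
        max (if r ≤ 1 then φ r else φ' 1 * Real.log r) 0 ^ p = 0 := by
    intro r hr
    rcases lt_trichotomy r 1 with h | rfl | h
    · refine ⟨φ'' r, hasDerivAt_ite_le_of_lt (hd2 r ⟨hr, h⟩) h, ?_⟩
      rw [if_pos h.le, if_pos h.le, max_eq_left (hpos r ⟨le_of_lt hr, h⟩).le]
      exact hode r ⟨hr, h⟩
    · refine ⟨-φ' 1, hasDerivAt_ite_le_self
        (hasDerivWithinAt_Iic_one_of_radial_ode hp0 (fun r hr => (hd1 r hr).continuousWithinAt)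
          hd1c hd2 hφ1 hode) ?_ (by simp), ?_⟩
      · simpa using (hinv 1 one_pos).hasDerivWithinAt
      · simp [hφ1, Real.zero_rpow hp0.ne']
    · refine ⟨_, hasDerivAt_ite_le_of_gt (hinv r hr) h, ?_⟩
      rw [max_eq_right (hneg r h).le, if_neg (not_le.2 h), Real.zero_rpow hp0.ne']
      have : r ≠ 0 := (mem_Ioi.1 hr).ne'
      field_simp
      ring
  refine ⟨fun r => if r ≤ 1 then φ' r else φ' 1 * r⁻¹, fun r hr => ?_, fun r hr => ?_, hneg,
    hsecond⟩
  · rcases lt_trichotomy r 1 with h | rfl | h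
    · simp only [if_pos h.le]
      exact hasDerivAt_ite_le_of_lt
        ((hd1 r ⟨le_of_lt hr, h.le⟩).hasDerivAt (Icc_mem_nhds hr h)) h
    · simp only [if_pos le_rfl]
      refine hasDerivAt_ite_le_self ?_ ?_ (by simp [hφ1])
      · exact (hd1 1 (by simp)).mono_of_mem_nhdsWithin (Icc_mem_nhdsLE one_pos)
      · simpa using (hlog 1 one_pos).hasDerivWithinAt
    · simp only [if_neg (not_le.2 h)]
      exact hasDerivAt_ite_le_of_gt (hlog r hr) h
  · obtain ⟨_, h, -⟩ := hsecond r hr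
    exact h.continuousAt.continuousWithinAt
end

section
/- For $h\in\{1,2\}$ one has $\displaystyle\int_{B_1(0)}\phi(|x|)^{p-1}\,\phi'(|x|)\,\frac{x_h^2}{|x|}\,dx=\frac{2\pi}{p}\,\phi'(1)$, i.e. the integral equals $-\tfrac{2\pi}{p}|\phi'(1)|$. -/
open Real Set MeasureTheory

/-- Polar coordinates for a radial function times the square of a coordinate on the unit disc. -/
theorem integral_ball_radial_mul_coord_sq (g : ℝ → ℝ) (h : Fin 2) :
    ∫ x in Metric.ball (0 : EuclideanSpace ℝ (Fin 2)) 1, g ‖x‖ * (x h) ^ 2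
      = π * ∫ r in (0 : ℝ)..1, r ^ 3 * g r := by
  have hangle : ∃ c : ℝ → ℝ, (∫ θ in Ioo (-π) π, c θ ^ 2) = π ∧
      ∀ r θ, 0 < r → Complex.orthonormalBasisOneI.repr (Complex.polarCoord.symm (r, θ)) h
        = r * c θ := by
    fin_cases h
    · refine ⟨cos, ?_, fun r θ _ => ?_⟩
      · rw [← integral_Ioc_eq_integral_Ioo,
          ← intervalIntegral.integral_of_le (by linarith [pi_pos]), integral_cos_sq]
        simp
      · simp [Complex.polarCoord_symm_apply, Complex.cos_ofReal_re]
    · refine ⟨sin, ?_, fun r θ _ => ?_⟩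
      · rw [← integral_Ioc_eq_integral_Ioo,
          ← intervalIntegral.integral_of_le (by linarith [pi_pos]), integral_sin_sq]
        simp
      · simp [Complex.polarCoord_symm_apply, Complex.sin_ofReal_re]
  obtain ⟨c, hc, hcoord⟩ := hangle
  rw [← integral_indicator Metric.isOpen_ball.measurableSet,
    ← (Complex.orthonormalBasisOneI.repr.measurePreserving).integral_comp
      Complex.orthonormalBasisOneI.repr.toHomeomorph.measurableEmbedding,
    ← Complex.integral_comp_polarCoord_symm, polarCoord_target]
  have hcongr : ∀ q ∈ Ioi (0 : ℝ) ×ˢ Ioo (-π) π,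
      q.1 • (Metric.ball (0 : EuclideanSpace ℝ (Fin 2)) 1).indicator
        (fun x => g ‖x‖ * (x h) ^ 2)
        (Complex.orthonormalBasisOneI.repr (Complex.polarCoord.symm q))
      = (Iio (1 : ℝ)).indicator (fun r => r ^ 3 * g r) q.1 * c q.2 ^ 2 := by
    rintro ⟨r, θ⟩ ⟨hr, -⟩
    have hr : 0 < r := hr
    have hnorm : ‖Complex.orthonormalBasisOneI.repr (Complex.polarCoord.symm (r, θ))‖ = r := by
      rw [LinearIsometryEquiv.norm_map, Complex.norm_polarCoord_symm, abs_of_pos hr]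
    simp only [indicator, mem_ball_zero_iff, hnorm, hcoord r θ hr, mem_Iio, smul_eq_mul]
    split_ifs <;> ring
  rw [setIntegral_congr_fun (measurableSet_Ioi.prod measurableSet_Ioo) hcongr,
    Measure.volume_eq_prod,
    setIntegral_prod_mul (fun r => (Iio (1 : ℝ)).indicator (fun r => r ^ 3 * g r) r)
      (fun θ => c θ ^ 2), hc, setIntegral_indicator measurableSet_Iio, Ioi_inter_Iio,
    intervalIntegral.integral_of_le zero_le_one, integral_Ioc_eq_integral_Ioo, mul_comm]

/-- For the radial profile `φ` of the positive solution of
`-Δφ = φ^p` in the unit ball of `ℝ²` vanishing on the boundary, and for each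
coordinate `h ∈ {1,2}`, one has
`∫_{B₁(0)} φ(|x|)^{p-1} φ'(|x|) x_h²/|x| dx = (2π/p) φ'(1) = -(2π/p) |φ'(1)|`. -/
theorem integral_phi_derivative_weighted (p : ℝ) (hp : 1 < p) (φ φ' φ'' : ℝ → ℝ)
    (hd1 : ∀ r ∈ Icc (0 : ℝ) 1, HasDerivWithinAt φ (φ' r) (Icc (0 : ℝ) 1) r)
    (hd1c : ContinuousOn φ' (Icc (0 : ℝ) 1))
    (hd2 : ∀ r ∈ Ioo (0 : ℝ) 1, HasDerivAt φ' (φ'' r) r)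
    (hpos : ∀ r ∈ Ico (0 : ℝ) 1, 0 < φ r) (hφ1 : φ 1 = 0)
    (hode : ∀ r ∈ Ioo (0 : ℝ) 1, φ'' r + (1 / r) * φ' r + φ r ^ p = 0) :
    ∀ h : Fin 2,
      (∫ x in Metric.ball (0 : EuclideanSpace ℝ (Fin 2)) 1,
          φ ‖x‖ ^ (p - 1) * φ' ‖x‖ * (x h) ^ 2 / ‖x‖)
        = 2 * π / p * φ' 1 ∧
      (∫ x in Metric.ball (0 : EuclideanSpace ℝ (Fin 2)) 1,
          φ ‖x‖ ^ (p - 1) * φ' ‖x‖ * (x h) ^ 2 / ‖x‖)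
        = -(2 * π / p) * |φ' 1| := by
  intro h
  have hp0 : 0 < p := by linarith
  have hφc : ContinuousOn φ (Icc 0 1) := fun r hr => (hd1 r hr).continuousWithinAt
  have hφd : ∀ r ∈ Ioo (0 : ℝ) 1, HasDerivAt φ (φ' r) r := fun r hr =>
    (hd1 r (Ioo_subset_Icc_self hr)).hasDerivAt (Icc_mem_nhds hr.1 hr.2)
  have hflux : ∀ r ∈ Ioo (0 : ℝ) 1,
      HasDerivAt (fun r => r * φ' r) (-(r * φ r ^ p)) r := by
    intro r hr
    refine ((hasDerivAt_id r).mul (hd2 r hr)).congr_deriv ?_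
    have hr0 : r ≠ 0 := hr.1.ne'
    have key := hode r hr
    field_simp at key
    simp only [id]
    linarith
  have hφ'1 : φ' 1 ≤ 0 := by
    have hanti : AntitoneOn (fun r => r * φ' r) (Icc 0 1) := by
      refine antitoneOn_of_deriv_nonpos (convex_Icc 0 1) (continuousOn_id.mul hd1c) ?_ ?_
      · rw [interior_Icc]
        exact fun r hr => (hflux r hr).differentiableAt.differentiableWithinAt
      · rw [interior_Icc]
        intro r hr
        rw [(hflux r hr).deriv, neg_nonpos]
        exact mul_nonneg hr.1.le (rpow_nonneg (hpos r ⟨hr.1.le, hr.2⟩).le p)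
    simpa using hanti (left_mem_Icc.2 zero_le_one) (right_mem_Icc.2 zero_le_one) zero_le_one
  have hradial : ∫ r in (0 : ℝ)..1, r ^ 2 * (φ r ^ (p - 1) * φ' r) = 2 / p * φ' 1 := by
    have hderiv : ∀ r ∈ Ioo (0 : ℝ) 1,
        HasDerivAt (fun r => (r ^ 2 * φ r ^ p + 2 * (r * φ' r)) / p)
          (r ^ 2 * (φ r ^ (p - 1) * φ' r)) r := by
      intro r hr
      refine ((((hasDerivAt_pow 2 r).mul ((hφd r hr).rpow_const (p := p) (Or.inr hp.le))).add
        ((hflux r hr).const_mul 2)).div_const p).congr_deriv ?_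
      field_simp
      push_cast
      ring
    rw [intervalIntegral.integral_eq_sub_of_hasDerivAt_of_le zero_le_one _ hderiv]
    · simp [hφ1, zero_rpow hp0.ne']
      ring
    · refine ContinuousOn.intervalIntegrable ?_
      rw [uIcc_of_le zero_le_one]
      exact (continuousOn_id.pow 2).mul
        ((hφc.rpow_const fun _ _ => Or.inr (by linarith)).mul hd1c)
    · exact ((((continuousOn_id.pow 2).mul
        (hφc.rpow_const fun _ _ => Or.inr hp0.le)).add
          (continuousOn_const.mul (continuousOn_id.mul hd1c))).div_const p)
  have hmain : (∫ x in Metric.ball (0 : EuclideanSpace ℝ (Fin 2)) 1,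
      φ ‖x‖ ^ (p - 1) * φ' ‖x‖ * (x h) ^ 2 / ‖x‖) = 2 * π / p * φ' 1 := by
    have hpolar := integral_ball_radial_mul_coord_sq (fun r => φ r ^ (p - 1) * φ' r / r) h
    have hcancel : ∀ r : ℝ, r ^ 3 * (φ r ^ (p - 1) * φ' r / r)
        = r ^ 2 * (φ r ^ (p - 1) * φ' r) := by
      intro r
      rcases eq_or_ne r 0 with rfl | hr
      · simp
      · field_simp
    simp only [hcancel, hradial, div_mul_eq_mul_div] at hpolar
    rw [hpolar]
    ring
  refine ⟨hmain, ?_⟩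
  rw [hmain, abs_of_nonpos hφ'1]
  ring
end

section
/- One has $\displaystyle\int_{B_s(0)}\bigl(W(|x|)-a\bigr)_+^{\,p+1}\,dx=\frac{\pi(p+1)}{2}\,\frac{\delta^2 a^2}{\bigl(\ln(R/s)\bigr)^2}$, where $t_+=\max(t,0)$ (on $B_s(0)$ one has $W(|x|)\ge a$, so the positive part may be omitted). -/
open Real Set MeasureTheory

/-- Radial integration over a disc in the plane. -/
lemma setIntegral_ball_fun_norm_fin_two (f : ℝ → ℝ) {s : ℝ} (hs : 0 ≤ s) :
    (∫ x in Metric.ball (0 : EuclideanSpace ℝ (Fin 2)) s, f ‖x‖)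
      = 2 * π * ∫ r in (0 : ℝ)..s, r * f r := by
  have hball : ∀ x : EuclideanSpace ℝ (Fin 2),
      (Metric.ball (0 : EuclideanSpace ℝ (Fin 2)) s).indicator (fun x => f ‖x‖) x
        = (Iio s).indicator f ‖x‖ := by
    intro x
    simp [indicator]
  have hvol : (volume : Measure (EuclideanSpace ℝ (Fin 2))).real (Metric.ball 0 1) = π := by
    simp [Measure.real, EuclideanSpace.volume_ball_fin_two, pi_pos.le]
  have hind : ∀ r : ℝ, r * (Iio s).indicator f r = (Iio s).indicator (fun r => r * f r) r := by
    intro r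
    by_cases h : r < s <;> simp [indicator, h]
  rw [← integral_indicator measurableSet_ball]
  simp_rw [hball]
  rw [integral_fun_norm_addHaar, hvol, intervalIntegral.integral_of_le hs,
    integral_Ioc_eq_integral_Ioo]
  simp only [finrank_euclideanSpace, Fintype.card_fin, Nat.add_one_sub_one, pow_one, smul_eq_mul,
    nsmul_eq_mul, hind, Nat.cast_ofNat]
  rw [setIntegral_indicator measurableSet_Iio, Ioi_inter_Iio, mul_assoc]

/-- Pohozaev identity on the unit interval for the planar radial Lane–Emden equation
`φ'' + φ' / r + φ ^ p = 0` with `φ 1 = 0`. -/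
lemma pohozaev_radial_laneEmden {p : ℝ} (hp : 0 < p) {φ φ' φ'' : ℝ → ℝ}
    (hd1 : ∀ r ∈ Icc (0 : ℝ) 1, HasDerivWithinAt φ (φ' r) (Icc (0 : ℝ) 1) r)
    (hd1c : ContinuousOn φ' (Icc (0 : ℝ) 1))
    (hd2 : ∀ r ∈ Ioo (0 : ℝ) 1, HasDerivAt φ' (φ'' r) r)
    (hpos : ∀ r ∈ Ico (0 : ℝ) 1, 0 < φ r) (hφ1 : φ 1 = 0)
    (hode : ∀ r ∈ Ioo (0 : ℝ) 1, φ'' r + (1 / r) * φ' r + φ r ^ p = 0) :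
    ∫ r in (0 : ℝ)..1, r * φ r ^ (p + 1) = (p + 1) / 4 * φ' 1 ^ 2 := by
  have hp1 : 0 < p + 1 := by linarith
  have hφc : ContinuousOn φ (Icc 0 1) := fun r hr => (hd1 r hr).continuousWithinAt
  have hpow : ContinuousOn (fun r => φ r ^ (p + 1)) (Icc 0 1) :=
    hφc.rpow_const fun _ _ => Or.inr hp1.le
  have hderiv : ∀ r ∈ Ioo (0 : ℝ) 1,
      HasDerivAt (fun r => (p + 1) / 4 * (r ^ 2 * φ' r ^ 2) + r ^ 2 * φ r ^ (p + 1) / 2)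
        (r * φ r ^ (p + 1)) r := by
    intro r hr
    have hr0 : r ≠ 0 := hr.1.ne'
    have hφr : 0 < φ r := hpos r ⟨hr.1.le, hr.2⟩
    have h1 : HasDerivAt φ (φ' r) r :=
      (hd1 r (Ioo_subset_Icc_self hr)).hasDerivAt (Icc_mem_nhds hr.1 hr.2)
    have h2 := h1.rpow_const (p := p + 1) (Or.inl hφr.ne')
    have hsq : HasDerivAt (fun r : ℝ => r ^ 2) (2 * r) r := by
      simpa using hasDerivAt_pow 2 r
    have h3 : φ'' r = -(1 / r * φ' r) - φ r ^ p := by linarith [hode r hr]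
    refine (((hsq.mul ((hd2 r hr).pow 2)).const_mul ((p + 1) / 4)).add
      ((hsq.mul h2).div_const 2)).congr_deriv ?_
    simp only [h3, add_sub_cancel_right, Pi.pow_apply]
    field_simp
    ring
  rw [intervalIntegral.integral_eq_sub_of_hasDerivAt_of_le zero_le_one _ hderiv]
  · simp [hφ1, zero_rpow hp1.ne']
  · exact ContinuousOn.intervalIntegrable (by
      rw [uIcc_of_le zero_le_one]
      exact continuousOn_id.mul hpow)
  · fun_prop

/-- The amplitude `δ ^ (2 / (p - 1)) * s ^ (-(2 / (p - 1)))` obeys the scaling of the nonlinearity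
`t ↦ t ^ p`. -/
lemma sq_mul_scaling_rpow {p δ s : ℝ} (hp : 1 < p) (hδ : 0 < δ) (hs : 0 < s) :
    s ^ 2 * (δ ^ (2 / (p - 1)) * s ^ (-(2 / (p - 1)))) ^ (p + 1)
      = δ ^ 2 * (δ ^ (2 / (p - 1)) * s ^ (-(2 / (p - 1)))) ^ 2 := by
  have hp0 : p - 1 ≠ 0 := by linarith
  have hC : 0 < δ ^ (2 / (p - 1)) * s ^ (-(2 / (p - 1))) := by positivity
  have hscale : (δ ^ (2 / (p - 1)) * s ^ (-(2 / (p - 1)))) ^ (p - 1) = δ ^ 2 * (s ^ 2)⁻¹ := by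
    rw [mul_rpow (by positivity) (by positivity), ← rpow_mul hδ.le, ← rpow_mul hs.le, neg_mul,
      div_mul_cancel₀ _ hp0, rpow_neg hs.le, rpow_two, rpow_two]
  rw [show p + 1 = (p - 1) + 2 by ring, rpow_add hC, hscale, rpow_two]
  field_simp

/-- For the radial profile `W` of the regularized vortex `W_{δ,a}`,
`∫_{B_s(0)} (W(|x|) - a)₊^{p+1} dx = (π(p+1)/2) · δ²a²/(log(R/s))²`. -/
theorem integral_vortex_pow_succ (p : ℝ) (hp : 1 < p) (φ φ' φ'' : ℝ → ℝ)
    (hd1 : ∀ r ∈ Icc (0 : ℝ) 1, HasDerivWithinAt φ (φ' r) (Icc (0 : ℝ) 1) r)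
    (hd1c : ContinuousOn φ' (Icc (0 : ℝ) 1))
    (hd2 : ∀ r ∈ Ioo (0 : ℝ) 1, HasDerivAt φ' (φ'' r) r)
    (hpos : ∀ r ∈ Ico (0 : ℝ) 1, 0 < φ r) (hφ1 : φ 1 = 0)
    (hode : ∀ r ∈ Ioo (0 : ℝ) 1, φ'' r + (1 / r) * φ' r + φ r ^ p = 0)
    (R δ a s : ℝ) (hR : 0 < R) (hδ : 0 < δ) (ha : 0 < a) (hs : s ∈ Ioo (0 : ℝ) R)
    (hmatch : δ ^ (2 / (p - 1)) * s ^ (-(2 / (p - 1))) * φ' 1 = a / Real.log (s / R))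
    (W : ℝ → ℝ)
    (hW : ∀ r : ℝ, W r =
      if r ≤ s then a + δ ^ (2 / (p - 1)) * s ^ (-(2 / (p - 1))) * φ (r / s)
      else a * Real.log (r / R) / Real.log (s / R)) :
    (∫ x in Metric.ball (0 : EuclideanSpace ℝ (Fin 2)) s, max (W ‖x‖ - a) 0 ^ (p + 1))
      = π * (p + 1) / 2 * (δ ^ 2 * a ^ 2 / (Real.log (R / s)) ^ 2) := by
  have hs0 : 0 < s := hs.1
  have hprofile : ∀ r ∈ Icc (0 : ℝ) 1, 0 ≤ φ r := fun r hr =>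
    hr.2.eq_or_lt.elim (fun h => by rw [h, hφ1]) fun h => (hpos r ⟨hr.1, h⟩).le
  have hmatch' : (a / Real.log (s / R)) ^ 2 = a ^ 2 / Real.log (R / s) ^ 2 := by
    rw [← inv_div R s, Real.log_inv, div_pow, neg_sq]
  have hscale := sq_mul_scaling_rpow hp hδ hs0
  set C := δ ^ (2 / (p - 1)) * s ^ (-(2 / (p - 1)))
  have hC0 : 0 < C := by positivity
  have hcore : ∀ r ∈ uIcc (0 : ℝ) s, r * max (W r - a) 0 ^ (p + 1)
      = s * C ^ (p + 1) * (r / s * φ (r / s) ^ (p + 1)) := by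
    intro r hr
    rw [uIcc_of_le hs0.le] at hr
    have hφr : 0 ≤ φ (r / s) :=
      hprofile _ ⟨div_nonneg hr.1 hs0.le, (div_le_one hs0).2 hr.2⟩
    rw [hW, if_pos hr.2, add_sub_cancel_left, max_eq_left (by positivity),
      mul_rpow hC0.le hφr]
    field_simp
  rw [setIntegral_ball_fun_norm_fin_two (fun r => max (W r - a) 0 ^ (p + 1)) hs0.le,
    intervalIntegral.integral_congr hcore, intervalIntegral.integral_const_mul,
    intervalIntegral.integral_comp_div (fun r => r * φ r ^ (p + 1)) hs0.ne', zero_div,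
    div_self hs0.ne', pohozaev_radial_laneEmden (by linarith) hd1 hd1c hd2 hpos hφ1 hode,
    smul_eq_mul, mul_div_assoc (δ ^ 2), ← hmatch', ← hmatch]
  linear_combination (π * (p + 1) / 2 * φ' 1 ^ 2) * hscale
end

section
/- One has $\displaystyle\int_{B_s(0)}\bigl(W(|x|)-a\bigr)_+^{\,p}\,dx=\frac{2\pi\,\delta^2 a}{\ln(R/s)}$, where $t_+=\max(t,0)$ (on $B_s(0)$ one has $W(|x|)\ge a$, so the positive part may be omitted). -/
open Real Set MeasureTheory

/-- Polar coordinates for a radial function on a disc centred at the origin of the plane. -/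
lemma setIntegral_ball_fun_norm (f : ℝ → ℝ) {s : ℝ} (hs : 0 ≤ s) :
    ∫ x in Metric.ball (0 : EuclideanSpace ℝ (Fin 2)) s, f ‖x‖
      = 2 * π * ∫ r in (0 : ℝ)..s, r * f r := by
  have hball : (Metric.ball (0 : EuclideanSpace ℝ (Fin 2)) s).indicator (fun x ↦ f ‖x‖)
      = fun x ↦ (Iio s).indicator f ‖x‖ := by
    ext x
    simp [indicator]
  have hmul : (fun r : ℝ ↦ r * (Iio s).indicator f r)
      = (Iio s).indicator fun r ↦ r * f r := by
    ext r
    simp [indicator]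
  have hvol : volume.real (Metric.ball (0 : EuclideanSpace ℝ (Fin 2)) 1) = π := by
    simp [measureReal_def, pi_nonneg]
  rw [← integral_indicator Metric.isOpen_ball.measurableSet, hball, integral_fun_norm_addHaar,
    hvol]
  simp only [finrank_euclideanSpace, Fintype.card_fin, Nat.add_one_sub_one, pow_one, smul_eq_mul,
    nsmul_eq_mul, Nat.cast_ofNat]
  rw [hmul, setIntegral_indicator measurableSet_Iio, Ioi_inter_Iio,
    intervalIntegral.integral_of_le hs, integral_Ioc_eq_integral_Ioo, mul_assoc]

/-- The radial form of the divergence theorem for `-Δφ = φ ^ p` on the unit disc. -/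
lemma integral_mul_rpow_eq_neg_deriv {p : ℝ} (hp : 0 ≤ p) {φ φ' φ'' : ℝ → ℝ}
    (hφ : ContinuousOn φ (Icc 0 1)) (hφ' : ContinuousOn φ' (Icc 0 1))
    (hd : ∀ r ∈ Ioo (0 : ℝ) 1, HasDerivAt φ' (φ'' r) r)
    (hode : ∀ r ∈ Ioo (0 : ℝ) 1, φ'' r + (1 / r) * φ' r + φ r ^ p = 0) :
    ∫ r in (0 : ℝ)..1, r * φ r ^ p = -φ' 1 := by
  have hcont : ContinuousOn (fun r ↦ r * φ r ^ p) (Icc 0 1) :=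
    continuousOn_id.mul (hφ.rpow_const fun _ _ ↦ Or.inr hp)
  have hder : ∀ r ∈ Ioo (0 : ℝ) 1, HasDerivAt (fun r ↦ -(r * φ' r)) (r * φ r ^ p) r := by
    intro r hr
    have hr0 : r ≠ 0 := hr.1.ne'
    have h := ((hasDerivAt_id r).mul (hd r hr)).neg
    have hode_r := hode r hr
    refine h.congr_deriv ?_
    field_simp at hode_r
    simp only [id]
    linarith
  rw [intervalIntegral.integral_eq_sub_of_hasDerivAt_of_le zero_le_one
    (continuousOn_id.mul hφ').neg hder
    (hcont.intervalIntegrable_of_Icc zero_le_one)]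
  simp

/-- The amplitude `C = δ ^ (2 / (p - 1)) * s ^ (-(2 / (p - 1)))` satisfies
`s ^ 2 * C ^ p = δ ^ 2 * C`. -/
lemma rpow_scaling {p δ s : ℝ} (hp : 1 < p) (hδ : 0 < δ) (hs : 0 < s) :
    s ^ 2 * (δ ^ (2 / (p - 1)) * s ^ (-(2 / (p - 1)))) ^ p
      = δ ^ 2 * (δ ^ (2 / (p - 1)) * s ^ (-(2 / (p - 1)))) := by
  have hp' : p - 1 ≠ 0 := by linarith
  have hexp : 2 / (p - 1) * p = 2 + 2 / (p - 1) := by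
    field_simp
    ring
  rw [mul_rpow (by positivity) (by positivity), ← rpow_mul hδ.le, ← rpow_mul hs.le, neg_mul, hexp,
    rpow_add hδ, neg_add, rpow_add hs, rpow_neg hs.le 2, rpow_two, rpow_two]
  field_simp

/-- For the radial profile `W` of the regularized vortex `W_{δ,a}`,
`∫_{B_s(0)} (W(|x|) - a)₊^{p} dx = 2π δ² a / log(R/s)` (the circulation of one
regularized vortex). -/
theorem integral_vortex_pow (p : ℝ) (hp : 1 < p) (φ φ' φ'' : ℝ → ℝ)
    (hd1 : ∀ r ∈ Icc (0 : ℝ) 1, HasDerivWithinAt φ (φ' r) (Icc (0 : ℝ) 1) r)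
    (hd1c : ContinuousOn φ' (Icc (0 : ℝ) 1))
    (hd2 : ∀ r ∈ Ioo (0 : ℝ) 1, HasDerivAt φ' (φ'' r) r)
    (hpos : ∀ r ∈ Ico (0 : ℝ) 1, 0 < φ r) (hφ1 : φ 1 = 0)
    (hode : ∀ r ∈ Ioo (0 : ℝ) 1, φ'' r + (1 / r) * φ' r + φ r ^ p = 0)
    (R δ a s : ℝ) (hR : 0 < R) (hδ : 0 < δ) (ha : 0 < a) (hs : s ∈ Ioo (0 : ℝ) R)
    (hmatch : δ ^ (2 / (p - 1)) * s ^ (-(2 / (p - 1))) * φ' 1 = a / Real.log (s / R))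
    (W : ℝ → ℝ)
    (hW : ∀ r : ℝ, W r =
      if r ≤ s then a + δ ^ (2 / (p - 1)) * s ^ (-(2 / (p - 1))) * φ (r / s)
      else a * Real.log (r / R) / Real.log (s / R)) :
    (∫ x in Metric.ball (0 : EuclideanSpace ℝ (Fin 2)) s, max (W ‖x‖ - a) 0 ^ p)
      = 2 * π * δ ^ 2 * a / Real.log (R / s) := by
  obtain ⟨hs0, -⟩ := hs
  set C := δ ^ (2 / (p - 1)) * s ^ (-(2 / (p - 1)))
  have hC0 : 0 < C := by positivity
  have hφ0 : ∀ r ∈ Icc (0 : ℝ) 1, 0 ≤ φ r := fun r hr ↦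
    hr.2.eq_or_lt.elim (fun h ↦ by rw [h, hφ1]) fun h ↦ (hpos r ⟨hr.1, h⟩).le
  have hintegrand : ∀ r ∈ uIcc 0 s, r * max (W r - a) 0 ^ p
      = (s * C ^ p) * (fun t ↦ t * φ t ^ p) (r / s) := by
    intro r hr
    rw [uIcc_of_le hs0.le] at hr
    have hφr := hφ0 (r / s) ⟨div_nonneg hr.1 hs0.le, div_le_one_of_le₀ hr.2 hs0.le⟩
    rw [hW, if_pos hr.2, add_sub_cancel_left, max_eq_left (by positivity),
      mul_rpow hC0.le hφr]
    field_simp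
  have hlog : Real.log (R / s) = -Real.log (s / R) := by
    rw [← Real.log_inv, inv_div]
  rw [setIntegral_ball_fun_norm (fun r ↦ max (W r - a) 0 ^ p) hs0.le,
    intervalIntegral.integral_congr hintegrand, intervalIntegral.integral_const_mul,
    intervalIntegral.integral_comp_div (fun t ↦ t * φ t ^ p) hs0.ne', zero_div, div_self hs0.ne',
    smul_eq_mul,
    integral_mul_rpow_eq_neg_deriv (by linarith) (fun r hr ↦ (hd1 r hr).continuousWithinAt)
      hd1c hd2 hode]
  calc 2 * π * (s * C ^ p * (s * -φ' 1)) = -(2 * π) * (s ^ 2 * C ^ p) * φ' 1 := by ring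
    _ = -(2 * π) * δ ^ 2 * (C * φ' 1) := by rw [rpow_scaling hp hδ hs0]; ring
    _ = 2 * π * δ ^ 2 * a / Real.log (R / s) := by rw [hmatch, hlog, div_neg]; ring
end
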